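/- arXiv:2202.00854 — 3 statements merged into one kernel-verified Lean document; each statement's English description precedes it below -/
import Mathlib

section
/- Let R be a reduced graph and let B be an induced cycle of R of even length at least 8. If some odd induced cycle of R has a vertex in common with B, then there exists an odd induced cycle C of R such that V(C) ∩ V(B) is nonempty and consists of consecutive vertices of B (i.e., the intersection is a nonempty sub-path of B). -/
/-! Common definitions: arc/interval representations, graph classes,
induced subgraph containment, small named graphs, reduced graphs. -/

/-- The point of the unit circle corresponding to parameter `t`. -/
noncomputable def circlePt (t : ℝ) : ℝ × ℝ :=
  (Real.cos (2 * Real.pi * t), Real.sin (2 * Real.pi * t))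

/-- A (nonempty closed) arc of the unit circle: the image under
`t ↦ (cos 2πt, sin 2πt)` of a closed interval `[a, b] ⊆ ℝ` with `0 ≤ b - a < 1`. -/
def IsUnitCircleArc (A : Set (ℝ × ℝ)) : Prop :=
  ∃ a b : ℝ, 0 ≤ b - a ∧ b - a < 1 ∧ A = circlePt '' Set.Icc a b

/-- An arc representation of a graph: each vertex gets an arc of the unit circle,
and two distinct vertices are adjacent iff their arcs intersect. -/
def IsArcRep {V : Type*} (G : SimpleGraph V) (f : V → Set (ℝ × ℝ)) : Prop :=
  (∀ v, IsUnitCircleArc (f v)) ∧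
    ∀ u v : V, u ≠ v → (G.Adj u v ↔ (f u ∩ f v).Nonempty)

/-- A family of sets is proper if no member is properly contained in another. -/
def ProperFamily {V α : Type*} (f : V → Set α) : Prop :=
  ∀ u v : V, ¬ f u ⊂ f v

/-- A family of sets is Helly if every subfamily of pairwise intersecting sets
has a common point. -/
def HellyFamily {V α : Type*} (f : V → Set α) : Prop :=
  ∀ S : Set V, (∀ u ∈ S, ∀ v ∈ S, (f u ∩ f v).Nonempty) → (⋂ v ∈ S, f v).Nonempty

/-- A proper circular-arc graph: admits an arc representation with no arc
properly contained in another. -/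
def IsProperCircularArcGraph {V : Type*} (G : SimpleGraph V) : Prop :=
  ∃ f : V → Set (ℝ × ℝ), IsArcRep G f ∧ ProperFamily f

/-- A proper Helly circular-arc graph: admits an arc representation that is
simultaneously proper and Helly. -/
def IsProperHellyCircularArcGraph {V : Type*} (G : SimpleGraph V) : Prop :=
  ∃ f : V → Set (ℝ × ℝ), IsArcRep G f ∧ ProperFamily f ∧ HellyFamily f

/-- An interval representation: each vertex gets a nonempty closed bounded
interval of ℝ; distinct vertices adjacent iff intervals intersect. -/
def IsIntervalRep {V : Type*} (G : SimpleGraph V) (f : V → Set ℝ) : Prop :=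
  (∀ v, ∃ a b : ℝ, a ≤ b ∧ f v = Set.Icc a b) ∧
    ∀ u v : V, u ≠ v → (G.Adj u v ↔ (f u ∩ f v).Nonempty)

def IsIntervalGraph {V : Type*} (G : SimpleGraph V) : Prop :=
  ∃ f : V → Set ℝ, IsIntervalRep G f

def IsProperIntervalGraph {V : Type*} (G : SimpleGraph V) : Prop :=
  ∃ f : V → Set ℝ, IsIntervalRep G f ∧ ProperFamily f

/-- A graph is bipartite: its vertices can be partitioned into two independent sets. -/
def IsBipartite {V : Type*} (G : SimpleGraph V) : Prop :=
  ∃ c : V → Bool, ∀ u v : V, G.Adj u v → c u ≠ c v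

/-- A permutation graph. -/
def IsPermutationGraph {V : Type*} (G : SimpleGraph V) : Prop :=
  ∃ a b : V → ℝ, Function.Injective a ∧ Function.Injective b ∧
    ∀ u v : V, u ≠ v → (G.Adj u v ↔ (a u - a v) * (b u - b v) < 0)

def IsBipartitePermutationGraph {V : Type*} (G : SimpleGraph V) : Prop :=
  IsPermutationGraph G ∧ IsBipartite G

/-- `f : ZMod ℓ → V` is an induced (chordless) cycle of length `ℓ ≥ 3` in `G`:
`f` is injective and two images are adjacent iff their indices are consecutive mod `ℓ`. -/
def IsInducedCycle {V : Type*} (G : SimpleGraph V) (ℓ : ℕ) (f : ZMod ℓ → V) : Prop :=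
  3 ≤ ℓ ∧ Function.Injective f ∧
    ∀ i j : ZMod ℓ, G.Adj (f i) (f j) ↔ (i = j + 1 ∨ j = i + 1)

/-- `G` contains `H` as an induced subgraph. -/
def ContainsInduced {V W : Type*} (G : SimpleGraph V) (H : SimpleGraph W) : Prop :=
  ∃ f : W → V, Function.Injective f ∧ ∀ u v : W, H.Adj u v ↔ G.Adj (f u) (f v)

/-- `G` contains `C_ℓ*`: an induced cycle of length `ℓ` together with a vertex
adjacent to no vertex of the cycle. -/
def HasCycleStar {V : Type*} (G : SimpleGraph V) (ℓ : ℕ) : Prop :=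
  ∃ (f : ZMod ℓ → V) (v : V), IsInducedCycle G ℓ f ∧ ∀ i : ZMod ℓ, ¬ G.Adj v (f i)

/-- A maximal clique. -/
def IsMaxClique {V : Type*} (G : SimpleGraph V) (s : Set V) : Prop :=
  G.IsClique s ∧ ∀ t : Set V, G.IsClique t → s ⊆ t → t = s

/-- A clique path: a linear arrangement of all maximal cliques of `G` such that
the cliques containing any fixed vertex are consecutive. -/
def IsCliquePath {W : Type*} (G : SimpleGraph W) (q : ℕ) (K : Fin q → Set W) : Prop :=
  Function.Injective K ∧ (∀ i, IsMaxClique G (K i)) ∧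
    (∀ s : Set W, IsMaxClique G s → ∃ i, K i = s) ∧
    ∀ (v : W) (i j k : Fin q), i ≤ j → j ≤ k → v ∈ K i → v ∈ K k → v ∈ K j

/-- A circular interval of residues mod `n`: `{p, p+1, …, p+m}`. -/
def IsCircInterval {n : ℕ} (s : Set (ZMod n)) : Prop :=
  ∃ (p : ZMod n) (m : ℕ), s = {x : ZMod n | ∃ k : ℕ, k ≤ m ∧ x = p + (k : ZMod n)}

/-! ### Small named graphs -/

/-- The claw `K_{1,3}`. -/
def clawG : SimpleGraph (Fin 4) := SimpleGraph.fromRel (fun u _ => u = 0)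

/-- The net: a triangle `{0,1,2}` with pendant vertices `3,4,5` attached to
`0,1,2` respectively. -/
def netG : SimpleGraph (Fin 6) :=
  SimpleGraph.fromRel (fun u v => (u.val < 3 ∧ v.val < 3) ∨ v.val = u.val + 3)

/-- The tent `S_3`: triangle `{0,1,2}`, independent set `{3,4,5}`, with
`3 ~ 0,1`, `4 ~ 1,2`, `5 ~ 2,0`. -/
def tentS3 : SimpleGraph (Fin 6) :=
  SimpleGraph.fromRel (fun u v =>
    (u.val < 3 ∧ v.val < 3) ∨ (u = 3 ∧ (v = 0 ∨ v = 1)) ∨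
      (u = 4 ∧ (v = 1 ∨ v = 2)) ∨ (u = 5 ∧ (v = 2 ∨ v = 0)))

/-- `S_3*`: the tent together with an isolated vertex `6`. -/
def S3star : SimpleGraph (Fin 7) :=
  SimpleGraph.fromRel (fun u v =>
    (u.val < 3 ∧ v.val < 3) ∨ (u = 3 ∧ (v = 0 ∨ v = 1)) ∨
      (u = 4 ∧ (v = 1 ∨ v = 2)) ∨ (u = 5 ∧ (v = 2 ∨ v = 0)))

/-- The complement of `S_3*`. -/
def compS3star : SimpleGraph (Fin 7) := S3starᶜ

/-- The complement of `C_4*`: two edges `0-2`, `1-3` plus a universal vertex `4`. -/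
def compC4star : SimpleGraph (Fin 5) :=
  SimpleGraph.fromRel (fun u v => (u = 0 ∧ v = 2) ∨ (u = 1 ∧ v = 3) ∨ u = 4)

/-- The chordless cycle `C_6`. -/
def cycle6G : SimpleGraph (Fin 6) :=
  SimpleGraph.fromRel (fun u v => v.val = (u.val + 1) % 6)

/-- The complement of `C_6`. -/
def compC6 : SimpleGraph (Fin 6) := cycle6Gᶜ

/-- The wheel `W_4`: a `C_4` on `{0,1,2,3}` plus a hub `4`. -/
def W4G : SimpleGraph (Fin 5) :=
  SimpleGraph.fromRel (fun u v => (u.val < 4 ∧ v.val = (u.val + 1) % 4) ∨ v = 4)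

/-- The wheel `W_5`: a `C_5` on `{0,…,4}` plus a hub `5`. -/
def W5G : SimpleGraph (Fin 6) :=
  SimpleGraph.fromRel (fun u v => (u.val < 5 ∧ v.val = (u.val + 1) % 5) ∨ v = 5)

/-- `F_1` (the long claw): the claw with each edge subdivided once. -/
def F1G : SimpleGraph (Fin 7) :=
  SimpleGraph.fromRel (fun u v =>
    (u = 0 ∧ v = 1) ∨ (u = 1 ∧ v = 2) ∨ (u = 0 ∧ v = 3) ∨ (u = 3 ∧ v = 4) ∨
      (u = 0 ∧ v = 5) ∨ (u = 5 ∧ v = 6))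

/-- `F_2`: a `C_4` `0-1-2-3-0` with pendant vertices `4,5,6` attached to `0,2,3`. -/
def F2G : SimpleGraph (Fin 7) :=
  SimpleGraph.fromRel (fun u v =>
    (u = 0 ∧ v = 1) ∨ (u = 1 ∧ v = 2) ∨ (u = 2 ∧ v = 3) ∨ (u = 3 ∧ v = 0) ∨
      (u = 0 ∧ v = 4) ∨ (u = 2 ∧ v = 5) ∨ (u = 3 ∧ v = 6))

/-- `F_3`: a `C_6` `0-1-2-3-4-5-0` with chord `0-3` and pendant `6` at `0`. -/
def F3G : SimpleGraph (Fin 7) :=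
  SimpleGraph.fromRel (fun u v =>
    (u.val < 6 ∧ v.val = (u.val + 1) % 6) ∨ (u = 0 ∧ v = 3) ∨ (u = 0 ∧ v = 6))

/-- `F_4`: a `C_6` `0-1-2-3-4-5-0` with chord `0-3` and a vertex `6` adjacent
exactly to `0` and `3`. -/
def F4G : SimpleGraph (Fin 7) :=
  SimpleGraph.fromRel (fun u v =>
    (u.val < 6 ∧ v.val = (u.val + 1) % 6) ∨ (u = 0 ∧ v = 3) ∨ (u = 6 ∧ (v = 0 ∨ v = 3)))

/-- A reduced graph: connected, co-connected, and containing none of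
`C_3*`, `C_5*`, the complement of `C_4*`, `C_6`, `S_3`, the complement of `S_3*`,
`F_1`, `F_2`, `F_3`, `F_4` as induced subgraphs. -/
def IsReducedGraph {V : Type*} (R : SimpleGraph V) : Prop :=
  R.Connected ∧ Rᶜ.Connected ∧
    ¬ HasCycleStar R 3 ∧ ¬ HasCycleStar R 5 ∧
    ¬ ContainsInduced R compC4star ∧
    ¬ (∃ f : ZMod 6 → V, IsInducedCycle R 6 f) ∧
    ¬ ContainsInduced R tentS3 ∧
    ¬ ContainsInduced R compS3star ∧
    ¬ ContainsInduced R F1G ∧ ¬ ContainsInduced R F2G ∧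
    ¬ ContainsInduced R F3G ∧ ¬ ContainsInduced R F4G

/-- An induced cycle described by a sequence indexed by natural numbers. -/
lemma isInducedCycle_of_nat {V : Type*} (G : SimpleGraph V) (n : ℕ) (hn : 3 ≤ n) (g : ℕ → V)
    (hne : ∀ i j, i < j → j < n → g i ≠ g j)
    (hadj : ∀ i j, i < j → j < n → (G.Adj (g i) (g j) ↔ (j = i + 1 ∨ (i = 0 ∧ j + 1 = n)))) :
    IsInducedCycle G n (fun x => g x.val) := by
  have : NeZero n := ⟨by omega⟩
  have : Fact (1 < n) := ⟨by omega⟩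
  have succ_iff : ∀ i j : ZMod n, i = j + 1 ↔ i.val = (j.val + 1) % n := by
    intro i j
    rw [← (ZMod.val_injective n).eq_iff, ZMod.val_add, ZMod.val_one]
  have key : ∀ a b : ℕ, a < n → b < n →
      (a = (b + 1) % n ↔ (a = b + 1 ∨ (a = 0 ∧ b + 1 = n))) := by
    intro a b ha hb
    rcases Nat.lt_or_ge (b + 1) n with h | h
    · rw [Nat.mod_eq_of_lt h]; omega
    · have : b + 1 = n := by omega
      rw [this, Nat.mod_self]; omega
  refine ⟨hn, ?_, ?_⟩
  · intro i j hij
    apply ZMod.val_injective n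
    by_contra hcon
    rcases Nat.lt_or_gt_of_ne hcon with h | h
    · exact hne _ _ h (ZMod.val_lt j) hij
    · exact hne _ _ h (ZMod.val_lt i) hij.symm
  · intro i j
    rw [succ_iff, succ_iff, key _ _ (ZMod.val_lt i) (ZMod.val_lt j),
      key _ _ (ZMod.val_lt j) (ZMod.val_lt i)]
    have hi := ZMod.val_lt i
    have hj := ZMod.val_lt j
    rcases Nat.lt_trichotomy i.val j.val with h | h | h
    · rw [hadj _ _ h hj]; omega
    · simp only [h, SimpleGraph.irrefl, false_iff]; omega
    · rw [G.adj_comm, hadj _ _ h hi]; omega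

/-- To exhibit an induced copy of a graph on `Fin n` it suffices to check increasing pairs. -/
lemma containsInduced_of_lt {V : Type*} {n : ℕ} (G : SimpleGraph V) (H : SimpleGraph (Fin n))
    (f : Fin n → V) (h : ∀ i j, i < j → f i ≠ f j ∧ (H.Adj i j ↔ G.Adj (f i) (f j))) :
    ContainsInduced G H := by
  refine ⟨f, ?_, ?_⟩
  · intro i j hij
    by_contra hcon
    rcases lt_or_gt_of_ne hcon with h' | h'
    · exact (h _ _ h').1 hij
    · exact (h _ _ h').1 hij.symm
  · intro i j
    rcases lt_trichotomy i j with h' | h' | h'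
    · exact (h _ _ h').2
    · simp [h']
    · rw [H.adj_comm, G.adj_comm]; exact (h _ _ h').2

/-- Some odd induced cycle of `R` meets the cycle `fB` in a nonempty set of consecutive
vertices. -/
def HasConsecutiveOddCycle {V : Type*} (R : SimpleGraph V) (ℓ : ℕ) (fB : ZMod ℓ → V) : Prop :=
  ∃ (ℓC : ℕ) (fC : ZMod ℓC → V), Odd ℓC ∧ IsInducedCycle R ℓC fC ∧
      (Set.range fC ∩ Set.range fB).Nonempty ∧
      IsCircInterval {i : ZMod ℓ | fB i ∈ Set.range fC}

section EvenHole

variable {V : Type*} {R : SimpleGraph V} {ℓ : ℕ} {fB : ZMod ℓ → V}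

lemma IsInducedCycle.ne_natCast (hB : IsInducedCycle R ℓ fB) {j k : ℕ} (hjk : j < k)
    (hk : k < j + ℓ) : fB j ≠ fB k := by
  intro h
  have h1 := (ZMod.natCast_eq_natCast_iff _ _ _).1 (hB.2.1 h)
  have := Nat.le_of_dvd (by omega) ((Nat.modEq_iff_dvd' hjk.le).1 h1)
  omega

lemma IsInducedCycle.adj_natCast (hB : IsInducedCycle R ℓ fB) {j k : ℕ} (hjk : j < k)
    (hk : k < j + ℓ) : R.Adj (fB j) (fB k) ↔ (k = j + 1 ∨ k + 1 = j + ℓ) := by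
  rw [hB.2.2]
  constructor
  · rintro (h | h)
    · have h1 : (j : ZMod ℓ) = ((k + 1 : ℕ) : ZMod ℓ) := by push_cast; exact h
      have h2 := (ZMod.natCast_eq_natCast_iff _ _ _).1 h1
      have := Nat.le_of_dvd (by omega) ((Nat.modEq_iff_dvd' (by omega)).1 h2)
      omega
    · have h1 : ((j + 1 : ℕ) : ZMod ℓ) = (k : ZMod ℓ) := by push_cast; exact h.symm
      have h2 := (ZMod.natCast_eq_natCast_iff _ _ _).1 h1
      by_contra hcon
      have := Nat.le_of_dvd (by omega) ((Nat.modEq_iff_dvd' (by omega)).1 h2)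
      omega
  · rintro (h | h)
    · right; rw [h]; push_cast; rfl
    · left
      have : ((k + 1 : ℕ) : ZMod ℓ) = ((j + ℓ : ℕ) : ZMod ℓ) := by rw [h]
      push_cast at this
      rw [this]; simp

/-- A segment of an induced cycle together with a sequence of outside vertices closing it up. -/
lemma hasConsecutiveOddCycle_of_segment (p d n : ℕ) (hdn : d < n)
    (hodd : Odd n) (g : ℕ → V) (hg : ∀ k ≤ d, g k = fB ((p + k : ℕ) : ZMod ℓ))
    (hout : ∀ k, d < k → k < n → g k ∉ Set.range fB) (hinj : Function.Injective fB)
    (hn : 3 ≤ n) (hne : ∀ i j, i < j → j < n → g i ≠ g j)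
    (hadj : ∀ i j, i < j → j < n → (R.Adj (g i) (g j) ↔ (j = i + 1 ∨ (i = 0 ∧ j + 1 = n)))) :
    HasConsecutiveOddCycle R ℓ fB := by
  have : NeZero n := ⟨by omega⟩
  have hmem : ∀ k < n, g k ∈ Set.range (fun x : ZMod n => g x.val) := by
    intro k hk
    exact ⟨(k : ZMod n), by simp only [ZMod.val_natCast, Nat.mod_eq_of_lt hk]⟩
  refine ⟨n, _, hodd, isInducedCycle_of_nat R n hn g hne hadj, ?_, (p : ZMod ℓ), d, ?_⟩
  · exact ⟨g 0, hmem 0 (by omega), _, (hg 0 (by omega)).symm⟩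
  · ext x
    constructor
    · rintro ⟨y, hy⟩
      have hy' : g y.val = fB x := hy
      by_cases hyd : y.val ≤ d
      · rw [hg _ hyd] at hy'
        exact ⟨y.val, hyd, by rw [← hinj hy']; push_cast; rfl⟩
      · exact absurd ⟨x, hy'.symm⟩ (hout _ (by omega) (ZMod.val_lt y))
    · rintro ⟨k, hk, rfl⟩
      have := hmem k (by omega)
      rw [hg k hk] at this
      push_cast at this
      exact this

lemma hasConsecutiveOddCycle_of_odd_gap (hB : IsInducedCycle R ℓ fB) (h8 : 8 ≤ ℓ)
    (heven : Even ℓ) {v : V} (hv : v ∉ Set.range fB) (d : ℕ) :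
    ∀ p : ℕ, Odd d → R.Adj v (fB p) → R.Adj v (fB ((p + d : ℕ) : ZMod ℓ)) →
      HasConsecutiveOddCycle R ℓ fB := by
  induction d using Nat.strong_induction_on with
  | _ d ih =>
  intro p hd hp hpd
  rcases Nat.lt_or_ge d (ℓ - 1) with hlt | hge
  · by_cases hk : ∃ k, 0 < k ∧ k < d ∧ R.Adj v (fB ((p + k : ℕ) : ZMod ℓ))
    · obtain ⟨k, hk0, hkd, hk⟩ := hk
      rcases Nat.even_or_odd k with he | ho
      · refine ih (d - k) (by omega) (p + k) (by grind) hk ?_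
        rwa [show p + k + (d - k) = p + d by omega]
      · exact ih k hkd p ho hp hk
    · push Not at hk
      have hk' : ∀ k ≤ d, R.Adj v (fB ((p + k : ℕ) : ZMod ℓ)) ↔ (k = 0 ∨ k = d) := by
        intro k hkd
        constructor
        · intro h
          by_contra hcon
          exact hk k (by omega) (by omega) h
        · rintro (rfl | rfl)
          · exact hp
          · exact hpd
      refine hasConsecutiveOddCycle_of_segment (R := R) p d (d + 2) (by omega) (by grind)
        (fun k => if k ≤ d then fB ((p + k : ℕ) : ZMod ℓ) else v) ?_ ?_ hB.2.1 (by grind) ?_ ?_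
      · intro k hk; simp [hk]
      · intro k hk _; simpa [Nat.not_le.2 hk] using hv
      · intro i j hij hj
        have hi : i ≤ d := by omega
        by_cases hjd : j ≤ d
        · simp only [hi, hjd, if_true]
          exact hB.ne_natCast (by omega) (by omega)
        · simp only [hi, hjd, if_true, if_false]
          exact fun h => hv ⟨_, h⟩
      · intro i j hij hj
        have hi : i ≤ d := by omega
        by_cases hjd : j ≤ d
        · simp only [hi, hjd, if_true]
          rw [hB.adj_natCast (by omega) (by omega)]; omega
        · simp only [hi, hjd, if_true, if_false]
          rw [R.adj_comm, hk' i hi]; omega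
  · rcases Nat.lt_or_ge d ℓ with h | h
    · refine ih 1 (by omega) (p + d) (by decide) hpd ?_
      rw [show p + d + 1 = p + ℓ by omega]
      simpa using hp
    · refine ih (d - ℓ) (by omega) p (by grind) hp ?_
      rw [show p + d = p + (d - ℓ) + ℓ by omega] at hpd
      rw [Nat.cast_add] at hpd
      simpa using hpd

lemma hasConsecutiveOddCycle_of_even_gap (hB : IsInducedCycle R ℓ fB) (h8 : 8 ≤ ℓ)
    (heven : Even ℓ) {u v : V} (hu : u ∉ Set.range fB) (hv : v ∉ Set.range fB)
    (huv : R.Adj u v) (d : ℕ) :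
    ∀ p : ℕ, Even d → R.Adj u (fB p) → R.Adj v (fB ((p + d : ℕ) : ZMod ℓ)) →
      HasConsecutiveOddCycle R ℓ fB := by
  induction d using Nat.strong_induction_on with
  | _ d ih =>
  intro p hd hp hpd
  rcases Nat.lt_or_ge d ℓ with hlt | hge
  · have hlt' : d + 1 < ℓ := by grind
    by_cases hku : ∃ k, 0 < k ∧ k ≤ d ∧ R.Adj u (fB ((p + k : ℕ) : ZMod ℓ))
    · obtain ⟨k, hk0, hkd, hk⟩ := hku
      rcases Nat.even_or_odd k with he | ho
      · refine ih (d - k) (by omega) (p + k) (by grind) hk ?_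
        rwa [show p + k + (d - k) = p + d by omega]
      · exact hasConsecutiveOddCycle_of_odd_gap hB h8 heven hu k p ho hp hk
    by_cases hkv : ∃ k, k < d ∧ R.Adj v (fB ((p + k : ℕ) : ZMod ℓ))
    · obtain ⟨k, hkd, hk⟩ := hkv
      rcases Nat.even_or_odd k with he | ho
      · exact ih k hkd p he hp hk
      · refine hasConsecutiveOddCycle_of_odd_gap hB h8 heven hv (d - k) (p + k) (by grind) hk ?_
        rwa [show p + k + (d - k) = p + d by omega]
    push Not at hku hkv
    have hku' : ∀ k ≤ d, R.Adj u (fB ((p + k : ℕ) : ZMod ℓ)) ↔ k = 0 := by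
      intro k hkd
      constructor
      · intro h
        by_contra hcon
        exact hku k (by omega) (by omega) h
      · rintro rfl
        exact hp
    have hkv' : ∀ k ≤ d, R.Adj v (fB ((p + k : ℕ) : ZMod ℓ)) ↔ k = d := by
      intro k hkd
      constructor
      · intro h
        by_contra hcon
        exact hkv k (by omega) h
      · rintro rfl
        exact hpd
    refine hasConsecutiveOddCycle_of_segment (R := R) p d (d + 3) (by omega) (by grind)
      (fun k => if k ≤ d then fB ((p + k : ℕ) : ZMod ℓ) else if k = d + 1 then v else u)
      ?_ ?_ hB.2.1 (by omega) ?_ ?_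
    · intro k hk; simp [hk]
    · intro k hk _
      simp only [Nat.not_le.2 hk, if_false]
      split_ifs <;> assumption
    · intro i j hij hj
      by_cases hi : i ≤ d
      · by_cases hjd : j ≤ d
        · simp only [hi, hjd, if_true]
          exact hB.ne_natCast (by omega) (by omega)
        · simp only [hi, hjd, if_true, if_false]
          split_ifs
          · exact fun h => hv ⟨_, h⟩
          · exact fun h => hu ⟨_, h⟩
      · obtain rfl : i = d + 1 := by omega
        obtain rfl : j = d + 2 := by omega
        simpa using huv.ne'
    · intro i j hij hj
      by_cases hi : i ≤ d
      · by_cases hjd : j ≤ d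
        · simp only [hi, hjd, if_true]
          rw [hB.adj_natCast (by omega) (by omega)]; omega
        · simp only [hi, hjd, if_true, if_false]
          split_ifs
          · rw [R.adj_comm, hkv' i hi]; omega
          · rw [R.adj_comm, hku' i hi]; omega
      · obtain rfl : i = d + 1 := by omega
        obtain rfl : j = d + 2 := by omega
        simpa using huv.symm
  · refine ih (d - ℓ) (by omega) p (by grind) hp ?_
    rw [show p + d = p + (d - ℓ) + ℓ by omega] at hpd
    rw [Nat.cast_add] at hpd
    simpa using hpd

/-- Any two indices on the cycle can be brought into increasing order by going around it. -/
lemma natCast_eq_add_mul_sub (hℓ : 0 < ℓ) (p q : ℕ) :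
    (q : ZMod ℓ) = ((p + (q + p * ℓ - p) : ℕ) : ZMod ℓ) := by
  have : p ≤ p * ℓ := Nat.le_mul_of_pos_right p hℓ
  rw [show p + (q + p * ℓ - p) = q + p * ℓ by omega]
  simp

lemma mod_two_add_mul_sub (heven : Even ℓ) (hℓ : 0 < ℓ) (p q : ℕ) :
    (q + p * ℓ - p) % 2 = (q + p) % 2 := by
  have : p ≤ p * ℓ := Nat.le_mul_of_pos_right p hℓ
  obtain ⟨m, rfl⟩ := heven
  rw [Nat.mul_add] at *
  omega

lemma parity_eq_of_adj (hB : IsInducedCycle R ℓ fB) (h8 : 8 ≤ ℓ) (heven : Even ℓ)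
    (hno : ¬ HasConsecutiveOddCycle R ℓ fB) {v : V} (hv : v ∉ Set.range fB) {p q : ℕ}
    (hp : R.Adj v (fB p)) (hq : R.Adj v (fB q)) : p % 2 = q % 2 := by
  by_contra hcon
  have h1 := mod_two_add_mul_sub heven (by omega) p q
  rw [natCast_eq_add_mul_sub (by omega) p q] at hq
  exact hno (hasConsecutiveOddCycle_of_odd_gap hB h8 heven hv _ p
    (Nat.odd_iff.2 (by omega)) hp hq)

lemma parity_ne_of_adj (hB : IsInducedCycle R ℓ fB) (h8 : 8 ≤ ℓ) (heven : Even ℓ)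
    (hno : ¬ HasConsecutiveOddCycle R ℓ fB) {u v : V} (hu : u ∉ Set.range fB)
    (hv : v ∉ Set.range fB) (huv : R.Adj u v) {p q : ℕ}
    (hp : R.Adj u (fB p)) (hq : R.Adj v (fB q)) : p % 2 ≠ q % 2 := by
  intro hcon
  have h1 := mod_two_add_mul_sub heven (by omega) p q
  rw [natCast_eq_add_mul_sub (by omega) p q] at hq
  exact hno (hasConsecutiveOddCycle_of_even_gap hB h8 heven hu hv huv _ p
    (Nat.even_iff.2 (by omega)) hp hq)

lemma containsInduced_F1G_of_arm (hB : IsInducedCycle R ℓ fB) (h8 : 8 ≤ ℓ) {v w : V}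
    (hw : w ∉ Set.range fB) (hv : v ∉ Set.range fB) (hwv : R.Adj w v)
    (hvB : ∀ k : ℕ, ¬ R.Adj (fB k) v) (m : ℕ)
    (h : ∀ k ≤ 4, R.Adj (fB ((m + k : ℕ) : ZMod ℓ)) w ↔ k = 2) :
    ContainsInduced R F1G := by
  have hwn : ∀ i, fB i ≠ w := fun i h => hw ⟨i, h⟩
  have hvn : ∀ i, fB i ≠ v := fun i h => hv ⟨i, h⟩
  have hne : ∀ j k, j < k → k ≤ 4 → fB ((m + j : ℕ) : ZMod ℓ) ≠ fB ((m + k : ℕ) : ZMod ℓ) :=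
    fun j k hj hk => hB.ne_natCast (by omega) (by omega)
  have hadj : ∀ j k, j < k → k ≤ 4 →
      (R.Adj (fB ((m + j : ℕ) : ZMod ℓ)) (fB ((m + k : ℕ) : ZMod ℓ)) ↔ k = j + 1) := by
    intro j k hj hk
    rw [hB.adj_natCast (by omega) (by omega)]; omega
  have hadj' : ∀ j k, j < k → k ≤ 4 →
      (R.Adj (fB ((m + k : ℕ) : ZMod ℓ)) (fB ((m + j : ℕ) : ZMod ℓ)) ↔ k = j + 1) := by
    intro j k hj hk
    rw [R.adj_comm, hadj j k hj hk]
  refine containsInduced_of_lt R F1G ![fB ((m + 2 : ℕ) : ZMod ℓ), fB ((m + 1 : ℕ) : ZMod ℓ),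
    fB ((m + 0 : ℕ) : ZMod ℓ), fB ((m + 3 : ℕ) : ZMod ℓ), fB ((m + 4 : ℕ) : ZMod ℓ), w, v] ?_
  intro i j hij
  constructor
  · fin_cases i <;> fin_cases j <;>
      first
      | exact absurd hij (by decide)
      | exact hwn _
      | exact hvn _
      | exact hwv.ne
      | exact hne _ _ (by decide) (by decide)
      | exact (hne _ _ (by decide) (by decide)).symm
  · fin_cases i <;> fin_cases j <;>
      first
      | exact absurd hij (by decide)
      | exact iff_of_true (by simp [F1G]) hwv
      | exact iff_of_false (by simp [F1G]) (hvB _)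
      | exact Iff.trans (by simp [F1G]) (h _ (by decide)).symm
      | exact Iff.trans (by simp [F1G]) (hadj _ _ (by decide) (by decide)).symm
      | exact Iff.trans (by simp [F1G]) (hadj' _ _ (by decide) (by decide)).symm

lemma containsInduced_F2G_of_pendant (hB : IsInducedCycle R ℓ fB) (h8 : 8 ≤ ℓ) {v w : V}
    (hw : w ∉ Set.range fB) (hv : v ∉ Set.range fB) (hwv : R.Adj w v)
    (hvB : ∀ k : ℕ, ¬ R.Adj (fB k) v) (m : ℕ)
    (h : ∀ k ≤ 4, R.Adj (fB ((m + k : ℕ) : ZMod ℓ)) w ↔ (k = 1 ∨ k = 3)) :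
    ContainsInduced R F2G := by
  have hwn : ∀ i, fB i ≠ w := fun i h => hw ⟨i, h⟩
  have hvn : ∀ i, fB i ≠ v := fun i h => hv ⟨i, h⟩
  have hne : ∀ j k, j < k → k ≤ 4 → fB ((m + j : ℕ) : ZMod ℓ) ≠ fB ((m + k : ℕ) : ZMod ℓ) :=
    fun j k hj hk => hB.ne_natCast (by omega) (by omega)
  have hadj : ∀ j k, j < k → k ≤ 4 →
      (R.Adj (fB ((m + j : ℕ) : ZMod ℓ)) (fB ((m + k : ℕ) : ZMod ℓ)) ↔ k = j + 1) := by
    intro j k hj hk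
    rw [hB.adj_natCast (by omega) (by omega)]; omega
  have hadj' : ∀ j k, j < k → k ≤ 4 →
      (R.Adj (fB ((m + k : ℕ) : ZMod ℓ)) (fB ((m + j : ℕ) : ZMod ℓ)) ↔ k = j + 1) := by
    intro j k hj hk
    rw [R.adj_comm, hadj j k hj hk]
  refine containsInduced_of_lt R F2G ![fB ((m + 1 : ℕ) : ZMod ℓ), fB ((m + 2 : ℕ) : ZMod ℓ),
    fB ((m + 3 : ℕ) : ZMod ℓ), w, fB ((m + 0 : ℕ) : ZMod ℓ), fB ((m + 4 : ℕ) : ZMod ℓ), v] ?_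
  intro i j hij
  constructor
  · fin_cases i <;> fin_cases j <;>
      first
      | exact absurd hij (by decide)
      | exact hwn _
      | exact (hwn _).symm
      | exact hvn _
      | exact hwv.ne
      | exact hne _ _ (by decide) (by decide)
      | exact (hne _ _ (by decide) (by decide)).symm
  · fin_cases i <;> fin_cases j <;>
      first
      | exact absurd hij (by decide)
      | exact iff_of_true (by simp [F2G]) hwv
      | exact iff_of_false (by simp [F2G]) (hvB _)
      | exact Iff.trans (by simp [F2G]) (h _ (by decide)).symm
      | exact Iff.trans (by simp [F2G]) ((R.adj_comm _ _).trans (h _ (by decide))).symm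
      | exact Iff.trans (by simp [F2G]) (hadj _ _ (by decide) (by decide)).symm
      | exact Iff.trans (by simp [F2G]) (hadj' _ _ (by decide) (by decide)).symm

/-- Without a long claw or `F_2`, and without an odd cycle as wanted, every neighbour of a vertex
attached to the hole is on the hole or attached to it. -/
lemma exists_adj_of_adj (hB : IsInducedCycle R ℓ fB) (h8 : 8 ≤ ℓ) (heven : Even ℓ)
    (hno : ¬ HasConsecutiveOddCycle R ℓ fB) (hF1 : ¬ ContainsInduced R F1G)
    (hF2 : ¬ ContainsInduced R F2G) {v w : V} (hw : w ∉ Set.range fB) (hv : v ∉ Set.range fB)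
    (hwv : R.Adj w v) {k : ℕ} (hk : R.Adj w (fB k)) : ∃ q : ℕ, R.Adj v (fB q) := by
  by_contra hcon
  push Not at hcon
  have hvB : ∀ q : ℕ, ¬ R.Adj (fB q) v := fun q h => hcon q h.symm
  have hpar : ∀ {p q : ℕ}, R.Adj (fB p) w → R.Adj (fB q) w → p % 2 = q % 2 :=
    fun hp hq => parity_eq_of_adj hB h8 heven hno hw hp.symm hq.symm
  have square : ∀ m : ℕ, R.Adj (fB ((m + 1 : ℕ) : ZMod ℓ)) w →
      R.Adj (fB ((m + 3 : ℕ) : ZMod ℓ)) w → False := by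
    intro m h1 h3
    refine hF2 (containsInduced_F2G_of_pendant hB h8 hw hv hwv hvB m ?_)
    intro k hk
    constructor
    · intro h
      have := hpar h1 h
      omega
    · rintro (rfl | rfl) <;> assumption
  set m := k + ℓ - 3 with hm
  have hk' : R.Adj (fB ((m + 3 : ℕ) : ZMod ℓ)) w := by
    rw [show m + 3 = k + ℓ by omega]
    simpa using hk.symm
  refine hF1 (containsInduced_F1G_of_arm hB h8 hw hv hwv hvB (m + 1) ?_)
  intro j hj
  constructor
  · intro h
    have h2 := hpar hk' h
    by_contra hj2
    obtain rfl | rfl : j = 0 ∨ j = 4 := by omega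
    · exact square m h hk'
    · exact square (m + 2) hk' h
  · rintro rfl
    exact hk'

lemma exists_adj_of_notMem_range (hconn : R.Connected) (hB : IsInducedCycle R ℓ fB) (h8 : 8 ≤ ℓ)
    (heven : Even ℓ) (hno : ¬ HasConsecutiveOddCycle R ℓ fB) (hF1 : ¬ ContainsInduced R F1G)
    (hF2 : ¬ ContainsInduced R F2G) {v : V} (hv : v ∉ Set.range fB) :
    ∃ q : ℕ, R.Adj v (fB q) := by
  have : NeZero ℓ := ⟨by omega⟩
  have step : ∀ {x y : V}, R.Walk x y → (x ∈ Set.range fB ∨ ∃ q : ℕ, R.Adj x (fB q)) →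
      (y ∈ Set.range fB ∨ ∃ q : ℕ, R.Adj y (fB q)) := by
    intro x y W
    induction W with
    | nil => exact id
    | @cons a b c hab _ ih =>
      intro ha
      apply ih
      by_cases hb : b ∈ Set.range fB
      · exact Or.inl hb
      right
      by_cases haB : a ∈ Set.range fB
      · obtain ⟨i, rfl⟩ := haB
        exact ⟨i.val, by simpa using hab.symm⟩
      · obtain ⟨q, hq⟩ := ha.resolve_left haB
        exact exists_adj_of_adj hB h8 heven hno hF1 hF2 haB hb hab hq
  obtain ⟨W⟩ := hconn.preconnected (fB 0) v
  exact (step W (Or.inl ⟨0, rfl⟩)).resolve_left hv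

end EvenHole

/-- An odd cycle admits no proper two-colouring. -/
lemma not_proper_of_odd_cycle {V : Type*} {R : SimpleGraph V} {n : ℕ} {f : ZMod n → V}
    (hn : Odd n) (hf : IsInducedCycle R n f) (c : V → ℕ) :
    ∃ x y, R.Adj x y ∧ c x % 2 = c y % 2 := by
  by_contra! hc
  have hk : ∀ k : ℕ, c (f k) % 2 = (c (f 0) + k) % 2 := by
    intro k
    induction k with
    | zero => simp
    | succ k ih =>
      have := hc (f k) (f ((k + 1 : ℕ) : ZMod n)) ((hf.2.2 _ _).2 (Or.inr (by push_cast; rfl)))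
      omega
  have h := hk n
  rw [ZMod.natCast_self] at h
  have := Nat.odd_iff.1 hn
  omega

/-- If some odd induced cycle of a reduced graph `R` meets an
induced cycle `B` of even length at least 8, then there is an odd induced cycle
of `R` whose intersection with `B` is a nonempty set of consecutive vertices of
`B`. -/
theorem odd_cycle_meeting_even_hole_consecutive {V : Type*} [Fintype V] (R : SimpleGraph V)
    (hR : IsReducedGraph R) (ℓ : ℕ) (fB : ZMod ℓ → V)
    (h8 : 8 ≤ ℓ) (heven : Even ℓ) (hB : IsInducedCycle R ℓ fB)
    (hex : ∃ (ℓC : ℕ) (fC : ZMod ℓC → V), Odd ℓC ∧ IsInducedCycle R ℓC fC ∧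
      (Set.range fC ∩ Set.range fB).Nonempty) :
    ∃ (ℓC : ℕ) (fC : ZMod ℓC → V), Odd ℓC ∧ IsInducedCycle R ℓC fC ∧
      (Set.range fC ∩ Set.range fB).Nonempty ∧
      IsCircInterval {i : ZMod ℓ | fB i ∈ Set.range fC} := by
  by_contra hno
  change ¬ HasConsecutiveOddCycle R ℓ fB at hno
  obtain ⟨hconn, -, -, -, -, -, -, -, hF1, hF2, -, -⟩ := hR
  have : NeZero ℓ := ⟨by omega⟩
  obtain ⟨n, f, hn, hf, -⟩ := hex
  have hcol : ∀ x : V, ∃ c : ℕ, (∃ k : ℕ, x = fB k ∧ c = k) ∨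
      (x ∉ Set.range fB ∧ ∃ k : ℕ, R.Adj x (fB k) ∧ c = k + 1) := by
    intro x
    by_cases hx : x ∈ Set.range fB
    · obtain ⟨i, rfl⟩ := hx
      exact ⟨i.val, Or.inl ⟨i.val, by simp, rfl⟩⟩
    · obtain ⟨q, hq⟩ := exists_adj_of_notMem_range hconn hB h8 heven hno hF1 hF2 hx
      exact ⟨q + 1, Or.inr ⟨hx, q, hq, rfl⟩⟩
  choose c hc using hcol
  obtain ⟨x, y, hxy, hcxy⟩ := not_proper_of_odd_cycle hn hf c
  have hsucc : ∀ j k : ℕ, (j : ZMod ℓ) = k + 1 → j % 2 ≠ k % 2 := by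
    intro j k h
    have h1 : (j : ZMod ℓ) = ((k + 1 : ℕ) : ZMod ℓ) := by push_cast; exact h
    have h2 := ((ZMod.natCast_eq_natCast_iff _ _ _).1 h1).of_dvd heven.two_dvd
    unfold Nat.ModEq at h2
    omega
  rcases hc x with ⟨j, rfl, hj⟩ | ⟨hx, j, hxj, hj⟩ <;>
    rcases hc y with ⟨k, rfl, hk⟩ | ⟨hy, k, hyk, hk⟩
  · rcases (hB.2.2 _ _).1 hxy with h | h
    · have := hsucc _ _ h
      omega
    · have := hsucc _ _ h
      omega
  · have := parity_eq_of_adj hB h8 heven hno hy hxy.symm hyk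
    omega
  · have := parity_eq_of_adj hB h8 heven hno hx hxy hxj
    omega
  · have := parity_ne_of_adj hB h8 heven hno hx hy hxy hxj hyk
    omega
end

section
/- Let R be a reduced graph and let B be an induced cycle of R of even length at least 8. If C is an odd induced cycle of R such that V(C) ∩ V(B) is nonempty and consists of consecutive vertices of B, then |V(C) ∩ V(B)| ≤ 4. -/
section InducedPatterns

variable {V : Type*} {R : SimpleGraph V}

lemma containsInduced_of_lt_s14 {n : ℕ} {H : SimpleGraph (Fin n)}
    (hH : ∀ u v, u ≠ v → ∃ w, ¬ (H.Adj u w ↔ H.Adj v w)) {f : Fin n → V}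
    (hf : ∀ u v, u < v → (H.Adj u v ↔ R.Adj (f u) (f v))) : ContainsInduced R H := by
  have key : ∀ u v, H.Adj u v ↔ R.Adj (f u) (f v) := by
    intro u v
    rcases lt_trichotomy u v with h | rfl | h
    · exact hf u v h
    · simp
    · rw [H.adj_comm, R.adj_comm]
      exact hf v u h
  refine ⟨f, fun u v huv => ?_, key⟩
  by_contra hne
  obtain ⟨w, hw⟩ := hH u v hne
  exact hw (by rw [key, key, huv])

set_option synthInstance.maxSize 2000 in
lemma containsInduced_F1G {a b b' c c' d d' : V}
    (h01 : R.Adj a b) (h12 : R.Adj b b') (h03 : R.Adj a c) (h34 : R.Adj c c')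
    (h05 : R.Adj a d) (h56 : R.Adj d d')
    (h02 : ¬ R.Adj a b') (h04 : ¬ R.Adj a c') (h06 : ¬ R.Adj a d')
    (h13 : ¬ R.Adj b c) (h14 : ¬ R.Adj b c') (h15 : ¬ R.Adj b d) (h16 : ¬ R.Adj b d')
    (h23 : ¬ R.Adj b' c) (h24 : ¬ R.Adj b' c') (h25 : ¬ R.Adj b' d) (h26 : ¬ R.Adj b' d')
    (h35 : ¬ R.Adj c d) (h36 : ¬ R.Adj c d') (h45 : ¬ R.Adj c' d) (h46 : ¬ R.Adj c' d') :
    ContainsInduced R F1G := by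
  refine containsInduced_of_lt_s14 (f := ![a, b, b', c, c', d, d']) ?_ ?_
  · simp only [F1G, SimpleGraph.fromRel_adj]
    decide
  · intro u v huv
    fin_cases u <;> fin_cases v <;> first | (exfalso; revert huv; decide) | simp [F1G, *]

set_option synthInstance.maxSize 2000 in
lemma containsInduced_F2G {a b c d a' c' d' : V}
    (h01 : R.Adj a b) (h12 : R.Adj b c) (h23 : R.Adj c d) (h03 : R.Adj a d)
    (h04 : R.Adj a a') (h25 : R.Adj c c') (h36 : R.Adj d d')
    (h02 : ¬ R.Adj a c) (h05 : ¬ R.Adj a c') (h06 : ¬ R.Adj a d')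
    (h13 : ¬ R.Adj b d) (h14 : ¬ R.Adj b a') (h15 : ¬ R.Adj b c') (h16 : ¬ R.Adj b d')
    (h24 : ¬ R.Adj c a') (h26 : ¬ R.Adj c d') (h34 : ¬ R.Adj d a') (h35 : ¬ R.Adj d c')
    (h45 : ¬ R.Adj a' c') (h46 : ¬ R.Adj a' d') (h56 : ¬ R.Adj c' d') :
    ContainsInduced R F2G := by
  refine containsInduced_of_lt_s14 (f := ![a, b, c, d, a', c', d']) ?_ ?_
  · simp only [F2G, SimpleGraph.fromRel_adj]
    decide
  · intro u v huv
    fin_cases u <;> fin_cases v <;> first | (exfalso; revert huv; decide) | simp [F2G, *]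

lemma hasCycleStar_of_fin {n : ℕ} (hn : 2 ≤ n) {f : Fin (n + 1) → V} {v : V}
    (twin : ∀ i j : Fin (n + 1),
      (∀ k, (i = k + 1 ∨ k = i + 1) ↔ (j = k + 1 ∨ k = j + 1)) → i = j)
    (hf : ∀ i j, R.Adj (f i) (f j) ↔ (i = j + 1 ∨ j = i + 1)) (hv : ∀ i, ¬ R.Adj v (f i)) :
    HasCycleStar R (n + 1) := by
  refine ⟨f, v, ⟨by omega, fun i j hij => twin i j fun k => ?_, hf⟩, hv⟩
  exact (hf i k).symm.trans (Iff.trans (by rw [hij]) (hf j k))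

lemma hasCycleStar_three {a b c v : V} (hab : R.Adj a b) (hbc : R.Adj b c) (hac : R.Adj a c)
    (ha : ¬ R.Adj v a) (hb : ¬ R.Adj v b) (hc : ¬ R.Adj v c) : HasCycleStar R 3 := by
  refine hasCycleStar_of_fin (f := ![a, b, c]) (v := v) le_rfl (by decide) (fun i j => ?_) ?_
  · fin_cases i <;> fin_cases j <;> simp [hab, hbc, hac, hab.symm, hbc.symm, hac.symm]
  · intro i
    fin_cases i <;> assumption

lemma hasCycleStar_five {a b c d e v : V} (hab : R.Adj a b) (hbc : R.Adj b c) (hcd : R.Adj c d)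
    (hde : R.Adj d e) (hae : R.Adj a e) (hac : ¬ R.Adj a c) (had : ¬ R.Adj a d)
    (hbd : ¬ R.Adj b d) (hbe : ¬ R.Adj b e) (hce : ¬ R.Adj c e)
    (ha : ¬ R.Adj v a) (hb : ¬ R.Adj v b) (hc : ¬ R.Adj v c) (hd : ¬ R.Adj v d)
    (he : ¬ R.Adj v e) : HasCycleStar R 5 := by
  refine hasCycleStar_of_fin (f := ![a, b, c, d, e]) (v := v) (by norm_num) (by decide)
    (fun i j => ?_) ?_
  · fin_cases i <;> fin_cases j <;>
      simp [hab, hbc, hcd, hde, hae, hac, had, hbd, hbe, hce, R.adj_comm b a, R.adj_comm c a,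
        R.adj_comm d a, R.adj_comm e a, R.adj_comm c b, R.adj_comm d b, R.adj_comm e b,
        R.adj_comm d c, R.adj_comm e c, R.adj_comm e d]
  · intro i
    fin_cases i <;> assumption

end InducedPatterns

/-- `b : ℤ → V` traverses an induced cycle of length `ℓ` periodically. -/
structure IsPeriodicCycle {V : Type*} (R : SimpleGraph V) (ℓ : ℤ) (b : ℤ → V) : Prop where
  eq_iff : ∀ x y, b x = b y ↔ ℓ ∣ x - y
  adj_iff : ∀ x y, R.Adj (b x) (b y) ↔ ℓ ∣ x - y - 1 ∨ ℓ ∣ x - y + 1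

lemma IsInducedCycle.isPeriodicCycle {V : Type*} {R : SimpleGraph V} {ℓ : ℕ} {f : ZMod ℓ → V}
    (hf : IsInducedCycle R ℓ f) (q : ZMod ℓ) :
    IsPeriodicCycle R ℓ (fun z : ℤ => f (q + z)) := by
  refine ⟨fun x y => ?_, fun x y => ?_⟩
  · rw [hf.2.1.eq_iff, add_right_inj, eq_comm, ZMod.intCast_eq_intCast_iff_dvd_sub]
  · rw [hf.2.2]
    have h1 : q + (x : ZMod ℓ) = q + y + 1 ↔ ((y + 1 : ℤ) : ZMod ℓ) = (x : ℤ) := by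
      rw [add_assoc, add_right_inj, eq_comm, Int.cast_add, Int.cast_one]
    have h2 : q + (y : ZMod ℓ) = q + x + 1 ↔ ((y : ℤ) : ZMod ℓ) = (x + 1 : ℤ) := by
      rw [add_assoc, add_right_inj, Int.cast_add, Int.cast_one]
    rw [h1, h2, ZMod.intCast_eq_intCast_iff_dvd_sub, ZMod.intCast_eq_intCast_iff_dvd_sub,
      sub_add_eq_sub_sub, add_sub_right_comm]

/-- `v` is nonadjacent to the three vertices around index `0`. -/
structure AvoidsZero {V : Type*} (R : SimpleGraph V) (b : ℤ → V) (v : V) : Prop where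
  zero : ¬ R.Adj v (b 0)
  one : ¬ R.Adj v (b 1)
  neg_one : ¬ R.Adj v (b (-1))

namespace IsPeriodicCycle

variable {V : Type*} {R : SimpleGraph V} {ℓ : ℤ} {b : ℤ → V}

lemma adj_succ (hb : IsPeriodicCycle R ℓ b) {x y : ℤ} (h : y = x + 1) : R.Adj (b x) (b y) := by
  rw [hb.adj_iff]
  right
  simp [h]

lemma adj_pred (hb : IsPeriodicCycle R ℓ b) {x y : ℤ} (h : x = y + 1) : R.Adj (b x) (b y) :=
  (hb.adj_succ h).symm

lemma not_adj (hb : IsPeriodicCycle R ℓ b) {x y : ℤ} (h : 2 ≤ y - x ∧ y - x ≤ ℓ - 2) :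
    ¬ R.Adj (b x) (b y) := by
  rw [hb.adj_iff]
  rintro (h' | h')
  · have := Int.le_of_dvd (by omega) ((dvd_neg).2 h')
    omega
  · have := Int.le_of_dvd (by omega) ((dvd_neg).2 h')
    omega

lemma not_adj' (hb : IsPeriodicCycle R ℓ b) {x y : ℤ} (h : 2 ≤ x - y ∧ x - y ≤ ℓ - 2) :
    ¬ R.Adj (b x) (b y) := fun h' => hb.not_adj h h'.symm

lemma add_period (hb : IsPeriodicCycle R ℓ b) {x y : ℤ} (h : x = y + ℓ) : b x = b y := by
  rw [hb.eq_iff]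
  simp [h]

lemma eq_shift (hb : IsPeriodicCycle R ℓ b) {x y x' y' : ℤ} (h : b x = b y)
    (h' : x' - y' = x - y) : b x' = b y' := by
  rwa [hb.eq_iff, h', ← hb.eq_iff]

lemma even_sub (hb : IsPeriodicCycle R ℓ b) (he : Even ℓ) {x y : ℤ} (h : b x = b y) :
    Even (x - y) := by
  rw [hb.eq_iff] at h
  exact even_iff_two_dvd.2 (he.two_dvd.trans h)

lemma eq_of_adj_zero (hb : IsPeriodicCycle R ℓ b) {x : ℤ} (h : R.Adj (b 0) (b x)) :
    b x = b 1 ∨ b x = b (-1) := by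
  rw [hb.adj_iff] at h
  rw [hb.eq_iff, hb.eq_iff]
  rcases h with h | h
  · right
    rwa [show x - -1 = -(0 - x - 1) by ring, dvd_neg]
  · left
    rwa [show x - 1 = -(0 - x + 1) by ring, dvd_neg]

lemma odd_sub_of_adj (hb : IsPeriodicCycle R ℓ b) (he : Even ℓ) {x y : ℤ}
    (h : R.Adj (b x) (b y)) : Odd (x - y) := by
  rw [hb.adj_iff] at h
  rcases h with h | h <;>
  · have := he.two_dvd.trans h
    rw [Int.odd_iff]
    omega

lemma zero_not_adj (hb : IsPeriodicCycle R ℓ b) {v : V} (hv : AvoidsZero R b v) {x : ℤ}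
    (h : R.Adj v (b x)) : ¬ R.Adj (b 0) (b x) := by
  intro h'
  rcases hb.eq_of_adj_zero h' with e | e <;> rw [e] at h
  exacts [hv.one h, hv.neg_one h]

lemma zero_not_adj_succ (hb : IsPeriodicCycle R ℓ b) {v w : V} (hv : AvoidsZero R b v)
    (hw : AvoidsZero R b w) {x y z : ℤ} (hx : R.Adj v (b x)) (hz : y = x + 1)
    (hy : R.Adj w (b z)) (hyz : z = y + 1 ∨ z = y + 2) : ¬ R.Adj (b 0) (b y) := by
  intro h'
  rcases hb.eq_of_adj_zero h' with e | e
  · exact hv.zero (hb.eq_shift e (x' := x) (y' := 0) (by omega) ▸ hx)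
  · rcases hyz with h | h
    · exact hw.zero (hb.eq_shift e (x' := z) (y' := 0) (by omega) ▸ hy)
    · exact hw.one (hb.eq_shift e (x' := z) (y' := 1) (by omega) ▸ hy)

lemma zero_not_adj_pred (hb : IsPeriodicCycle R ℓ b) {v w : V} (hv : AvoidsZero R b v)
    (hw : AvoidsZero R b w) {x y z : ℤ} (hx : R.Adj v (b x)) (hz : x = y + 1)
    (hy : R.Adj w (b z)) (hyz : y = z + 2) : ¬ R.Adj (b 0) (b y) := by
  intro h'
  rcases hb.eq_of_adj_zero h' with e | e
  · exact hw.neg_one (hb.eq_shift e (x' := z) (y' := -1) (by omega) ▸ hy)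
  · exact hv.zero (hb.eq_shift e (x' := x) (y' := 0) (by omega) ▸ hx)

/-- The neighbours on the cycle of a vertex avoiding index `0` have indices of a single parity. -/
lemma even_sub_of_adj_adj (hb : IsPeriodicCycle R ℓ b) (h8 : 8 ≤ ℓ) (he : Even ℓ)
    (h3 : ¬ HasCycleStar R 3) (h5 : ¬ HasCycleStar R 5) (hF1 : ¬ ContainsInduced R F1G)
    (hF2 : ¬ ContainsInduced R F2G) {v : V} (hv : AvoidsZero R b v)
    {x y : ℤ} (hx : R.Adj v (b x)) (hy : R.Adj v (b y)) : Even (x - y) := by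
  by_contra hxy
  classical
  have hex : ∃ g : ℕ, Odd g ∧ ∃ i : ℤ, R.Adj v (b i) ∧ R.Adj v (b (i + g)) := by
    rw [Int.not_even_iff_odd] at hxy
    refine ⟨(x - y).natAbs, Int.natAbs_odd.2 hxy, ?_⟩
    rcases le_total x y with h | h
    · exact ⟨x, hx, by rwa [show x + ((x - y).natAbs : ℤ) = y by omega]⟩
    · exact ⟨y, hy, by rwa [show y + ((x - y).natAbs : ℤ) = x by omega]⟩
  obtain ⟨hg, i, hi, hig⟩ := Nat.find_spec hex
  have hmin := fun (m : ℕ) (hm : m < Nat.find hex) => Nat.find_min hex hm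
  set g := Nat.find hex
  have hmin' : ∀ s t : ℤ, Odd (t - s) → 0 < t - s → t - s < g →
      R.Adj v (b s) → ¬ R.Adj v (b t) := by
    intro s t hodd h0 h1 hs ht
    refine hmin (t - s).toNat (by omega) ⟨?_, s, hs, ?_⟩
    · rw [← Int.odd_coe_nat, Int.toNat_of_nonneg h0.le]
      exact hodd
    · rwa [Int.toNat_of_nonneg h0.le, add_sub_cancel]
  rw [Nat.odd_iff] at hg
  rw [Int.even_iff] at he
  have hgl : (g : ℤ) < ℓ := by
    by_contra hlt
    refine hmin' i (i + g - ℓ) ?_ (by omega) (by omega) hi ?_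
    · rw [Int.odd_iff]
      omega
    · rwa [← hb.add_period (x := i + g) (by ring)]
  have hgl' : (g : ℤ) + 4 < ℓ ∨ g ≤ 3 := by
    by_contra hlt
    refine hmin' (i + g) (i + ℓ) ?_ (by omega) (by omega) hig ?_
    · rw [Int.odd_iff]
      omega
    · rwa [hb.add_period (x := i + ℓ) rfl]
  have hlt : ∀ s t : ℤ, (t - s) % 2 = 1 → 0 < t - s → t - s < g →
      R.Adj v (b s) → ¬ R.Adj v (b t) := fun s t h => hmin' s t (Int.odd_iff.2 h)
  have hbetween : ∀ t : ℤ, i < t → t < i + g → ¬ R.Adj v (b t) := by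
    intro t h1 h2 ht
    rcases Int.emod_two_eq_zero_or_one (t - i) with h | h
    · exact hlt t (i + g) (by omega) (by omega) (by omega) ht hig
    · exact hlt i t (by omega) (by omega) (by omega) hi ht
  have hbefore : ∀ t : ℤ, (i - t) % 2 = 1 → 0 < i - t → i - t < g → ¬ R.Adj v (b t) :=
    fun t h1 h2 h3 ht => hlt t i h1 h2 h3 ht hi
  by_cases hg1 : g = 1
  · rw [hg1] at hig
    exact h3 (hasCycleStar_three hi (hb.adj_succ rfl) hig (fun h => hv.zero h.symm)
      (hb.zero_not_adj hv hi) (hb.zero_not_adj hv hig))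
  by_cases hg3 : g = 3
  · rw [hg3] at hig hbetween
    exact h5 (hasCycleStar_five hi (hb.adj_succ rfl) (hb.adj_succ (y := i + 2) (by ring))
      (hb.adj_succ (by push_cast; ring)) hig (hbetween _ (by omega) (by omega))
      (hbetween _ (by omega) (by omega)) (hb.not_adj (by omega)) (hb.not_adj (by omega))
      (hb.not_adj (by omega)) (fun h => hv.zero h.symm) (hb.zero_not_adj hv hi)
      (hb.zero_not_adj_succ hv hv hi rfl hig (by omega))
      (hb.zero_not_adj_pred hv hv hig (by omega) hi (by omega)) (hb.zero_not_adj hv hig))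
  by_cases h2 : R.Adj v (b (i - 2))
  · exact hF2 (containsInduced_F2G (a := b i) (b := b (i - 1)) (c := b (i - 2)) (d := v)
      (a' := b (i + 1)) (c' := b (i - 3)) (d' := b (i + g))
      (hb.adj_pred (by omega)) (hb.adj_pred (by omega)) h2.symm hi.symm
      (hb.adj_succ (by omega)) (hb.adj_pred (by omega)) hig
      (hb.not_adj' (by omega)) (hb.not_adj' (by omega)) (hb.not_adj (by omega))
      (fun h => hbefore _ (by omega) (by omega) (by omega) h.symm)
      (hb.not_adj (by omega)) (hb.not_adj' (by omega)) (hb.not_adj (by omega))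
      (hb.not_adj (by omega)) (hb.not_adj (by omega))
      (hbetween _ (by omega) (by omega)) (hbefore _ (by omega) (by omega) (by omega))
      (hb.not_adj' (by omega)) (hb.not_adj (by omega)) (hb.not_adj (by omega)))
  · exact hF1 (containsInduced_F1G (a := b i) (b := b (i + 1)) (b' := b (i + 2))
      (c := b (i - 1)) (c' := b (i - 2)) (d := v) (d' := b (i + g))
      (hb.adj_succ (by omega)) (hb.adj_succ (by omega))
      (hb.adj_pred (by omega)) (hb.adj_pred (by omega)) hi.symm hig
      (hb.not_adj (by omega)) (hb.not_adj' (by omega)) (hb.not_adj (by omega))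
      (hb.not_adj' (by omega)) (hb.not_adj' (by omega))
      (fun h => hbetween _ (by omega) (by omega) h.symm) (hb.not_adj (by omega))
      (hb.not_adj' (by omega)) (hb.not_adj' (by omega))
      (fun h => hbetween _ (by omega) (by omega) h.symm) (hb.not_adj (by omega))
      (fun h => hbefore _ (by omega) (by omega) (by omega) h.symm) (hb.not_adj (by omega))
      (fun h => h2 h.symm) (hb.not_adj (by omega)))

/-- Of two adjacent vertices avoiding index `0`, if the first has a neighbour on the cycle, then the
second has a neighbour of the opposite parity. -/
lemma exists_adj_odd_sub (hb : IsPeriodicCycle R ℓ b) (h8 : 8 ≤ ℓ) (he : Even ℓ)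
    (h3 : ¬ HasCycleStar R 3) (h5 : ¬ HasCycleStar R 5) (hF1 : ¬ ContainsInduced R F1G)
    (hF2 : ¬ ContainsInduced R F2G) {v w : V} (hv : AvoidsZero R b v) (hw : AvoidsZero R b w)
    (hvw : R.Adj v w) {i : ℤ} (hi : R.Adj v (b i)) : ∃ j, R.Adj w (b j) ∧ Odd (j - i) := by
  by_contra! hno
  have hwpar : ∀ j, (j - i) % 2 = 1 → ¬ R.Adj w (b j) :=
    fun j hj h => hno j h (Int.odd_iff.2 hj)
  have hvpar : ∀ j, (j - i) % 2 = 1 → ¬ R.Adj v (b j) := by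
    intro j hj h
    have := hb.even_sub_of_adj_adj h8 he h3 h5 hF1 hF2 hv h hi
    rw [Int.even_iff] at this
    omega
  have hvmod : ∀ j, R.Adj v (b j) → (j - i) % 2 = 0 := by
    intro j h
    by_contra h'
    exact hvpar j (by omega) h
  have hdisj : ∀ j, R.Adj v (b j) → ¬ R.Adj w (b j) := fun j hj hj' =>
    h3 (hasCycleStar_three hvw hj' hj (fun h => hv.zero h.symm) (fun h => hw.zero h.symm)
      (hb.zero_not_adj hv hj))
  have hfwd : ∀ j k, k = j + 2 → R.Adj v (b j) → ¬ R.Adj w (b k) := by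
    rintro j k hk hj hj'
    have h1 := hvmod j hj
    exact h5 (hasCycleStar_five hj (hb.adj_succ rfl) (hb.adj_succ (by omega)) hj'.symm hvw
      (hvpar _ (by omega)) (fun h => hdisj _ h hj') (hb.not_adj (by omega))
      (fun h => hdisj _ hj h.symm) (fun h => hwpar _ (by omega) h.symm)
      (fun h => hv.zero h.symm) (hb.zero_not_adj hv hj)
      (hb.zero_not_adj_succ hv hw hj rfl hj' (by omega)) (hb.zero_not_adj hw hj')
      (fun h => hw.zero h.symm))
  have hbwd : ∀ j k, j = k + 2 → R.Adj v (b j) → ¬ R.Adj w (b k) := by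
    rintro j k hk hj hj'
    have h1 := hvmod j hj
    exact h5 (hasCycleStar_five hj' (hb.adj_succ rfl) (hb.adj_succ (by omega)) hj.symm hvw.symm
      (hwpar _ (by omega)) (fun h => hdisj _ hj h) (hb.not_adj (by omega))
      (fun h => hdisj _ h.symm hj') (fun h => hvpar _ (by omega) h.symm)
      (fun h => hw.zero h.symm) (hb.zero_not_adj hw hj')
      (hb.zero_not_adj_succ hw hv hj' rfl hj (by omega)) (hb.zero_not_adj hv hj)
      (fun h => hv.zero h.symm))
  by_cases hF : ∃ j, R.Adj v (b j) ∧ R.Adj v (b (j + 2))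
  · obtain ⟨j, hj, hj2⟩ := hF
    have h1 := hvmod j hj
    exact hF2 (containsInduced_F2G (a := b j) (b := b (j + 1)) (c := b (j + 2)) (d := v)
      (a' := b (j - 1)) (c' := b (j + 3)) (d' := w)
      (hb.adj_succ (by omega)) (hb.adj_succ (by omega)) hj2.symm hj.symm
      (hb.adj_pred (by omega)) (hb.adj_succ (by omega)) hvw
      (hb.not_adj (by omega)) (hb.not_adj (by omega)) (fun h => hdisj _ hj h.symm)
      (fun h => hvpar _ (by omega) h.symm)
      (hb.not_adj' (by omega)) (hb.not_adj (by omega)) (fun h => hwpar _ (by omega) h.symm)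
      (hb.not_adj' (by omega)) (fun h => hdisj _ hj2 h.symm)
      (hvpar _ (by omega)) (hvpar _ (by omega))
      (hb.not_adj (by omega)) (fun h => hwpar _ (by omega) h.symm)
      (fun h => hwpar _ (by omega) h.symm))
  · push Not at hF
    exact hF1 (containsInduced_F1G (a := b i) (b := b (i + 1)) (b' := b (i + 2))
      (c := b (i - 1)) (c' := b (i - 2)) (d := v) (d' := w)
      (hb.adj_succ (by omega)) (hb.adj_succ (by omega))
      (hb.adj_pred (by omega)) (hb.adj_pred (by omega)) hi.symm hvw
      (hb.not_adj (by omega)) (hb.not_adj' (by omega)) (fun h => hdisj _ hi h.symm)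
      (hb.not_adj' (by omega)) (hb.not_adj' (by omega))
      (fun h => hvpar _ (by omega) h.symm) (fun h => hwpar _ (by omega) h.symm)
      (hb.not_adj' (by omega)) (hb.not_adj' (by omega))
      (fun h => hF _ hi h.symm) (fun h => hfwd _ _ rfl hi h.symm)
      (fun h => hvpar _ (by omega) h.symm) (fun h => hwpar _ (by omega) h.symm)
      (fun h => hF (i - 2) h.symm (by rwa [sub_add_cancel]))
      (fun h => hbwd _ _ (by omega) hi h.symm))

/-- No closed walk of odd length through `b 0` has all its vertices off the cycle in
`AvoidsZero`. -/
lemma not_odd_closed_walk (hb : IsPeriodicCycle R ℓ b) (h8 : 8 ≤ ℓ) (he : Even ℓ)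
    (h3 : ¬ HasCycleStar R 3) (h5 : ¬ HasCycleStar R 5) (hF1 : ¬ ContainsInduced R F1G)
    (hF2 : ¬ ContainsInduced R F2G) {n : ℕ} (hn : Odd n) {g : ℕ → V}
    (hg : ∀ j, R.Adj (g j) (g (j + 1))) (hg0 : g 0 = b 0) (hgn : g n = b 0)
    (hav : ∀ j, g j ∉ Set.range b → AvoidsZero R b (g j)) : False := by
  have key : ∀ j : ℕ, (∀ x, g j = b x → Even (x - j)) ∧
      (g j ∉ Set.range b → ∃ x, R.Adj (g j) (b x) ∧ Odd (x - j)) := by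
    intro j
    induction j with
    | zero =>
      refine ⟨fun x hx => ?_, fun h => (h ⟨0, hg0.symm⟩).elim⟩
      simpa using hb.even_sub he (hx.symm.trans hg0)
    | succ j ih =>
      obtain ⟨ih1, ih2⟩ := ih
      have hadj := hg j
      by_cases hj : g j ∈ Set.range b
      · obtain ⟨x, hx⟩ := hj
        have hpar := ih1 x hx.symm
        rw [← hx] at hadj
        refine ⟨fun y hy => ?_, fun _ => ⟨x, hadj.symm, ?_⟩⟩
        · rw [hy] at hadj
          have := hb.odd_sub_of_adj he hadj
          rw [Int.odd_iff] at this
          rw [Int.even_iff] at hpar ⊢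
          push_cast
          omega
        · rw [Int.even_iff] at hpar
          rw [Int.odd_iff]
          push_cast
          omega
      · obtain ⟨x, hx, hpar⟩ := ih2 hj
        rw [Int.odd_iff] at hpar
        refine ⟨fun y hy => ?_, fun hj' => ?_⟩
        · rw [hy] at hadj
          have := hb.even_sub_of_adj_adj h8 he h3 h5 hF1 hF2 (hav j hj) hx hadj
          rw [Int.even_iff] at this ⊢
          push_cast
          omega
        · obtain ⟨y, hy, hyx⟩ := hb.exists_adj_odd_sub h8 he h3 h5 hF1 hF2 (hav j hj)
            (hav (j + 1) hj') hadj hx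
          refine ⟨y, hy, ?_⟩
          rw [Int.odd_iff] at hyx ⊢
          push_cast
          omega
  have := (key n).1 0 hgn
  rw [Nat.odd_iff] at hn
  rw [Int.even_iff] at this
  omega

end IsPeriodicCycle

lemma IsInducedCycle.eq_or_eq_of_adj {V : Type*} {R : SimpleGraph V} {n : ℕ} {f : ZMod n → V}
    (hf : IsInducedCycle R n f) {u x y z : V} (hu : u ∈ Set.range f) (hx : x ∈ Set.range f)
    (hy : y ∈ Set.range f) (hz : z ∈ Set.range f) (hxy : x ≠ y) (hux : R.Adj u x)
    (huy : R.Adj u y) (huz : R.Adj u z) : z = x ∨ z = y := by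
  obtain ⟨u, rfl⟩ := hu
  obtain ⟨x, rfl⟩ := hx
  obtain ⟨y, rfl⟩ := hy
  obtain ⟨z, rfl⟩ := hz
  rw [hf.2.2, ← sub_eq_iff_eq_add, eq_comm (a := u - 1)] at hux huy huz
  rw [hf.2.1.ne_iff] at hxy
  rw [hf.2.1.eq_iff, hf.2.1.eq_iff]
  grind

/-- If `C` is an odd induced cycle of a reduced graph `R` whose
intersection with an induced cycle `B` of even length at least 8 is a nonempty
set of consecutive vertices of `B`, then `|V(C) ∩ V(B)| ≤ 4`. -/
theorem odd_cycle_consecutive_intersection_le_four {V : Type*} [Fintype V] (R : SimpleGraph V)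
    (hR : IsReducedGraph R) (ℓ : ℕ) (fB : ZMod ℓ → V)
    (h8 : 8 ≤ ℓ) (heven : Even ℓ) (hB : IsInducedCycle R ℓ fB)
    (ℓC : ℕ) (fC : ZMod ℓC → V) (hodd : Odd ℓC) (hC : IsInducedCycle R ℓC fC)
    (hne : (Set.range fC ∩ Set.range fB).Nonempty)
    (hconsec : IsCircInterval {i : ZMod ℓ | fB i ∈ Set.range fC}) :
    (Set.range fC ∩ Set.range fB).ncard ≤ 4 := by
  obtain ⟨-, -, h3, h5, -, -, -, -, hF1, hF2, -, -⟩ := hR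
  obtain ⟨p, m, hpm⟩ := hconsec
  have hsub : Set.range fC ∩ Set.range fB ⊆
      (fun k : ℕ => fB (p + k)) '' (Finset.range (m + 1) : Set ℕ) := by
    rintro _ ⟨hc, i, rfl⟩
    obtain ⟨k, hk, rfl⟩ : i ∈ {x : ZMod ℓ | ∃ k : ℕ, k ≤ m ∧ x = p + (k : ZMod ℓ)} := hpm ▸ hc
    exact ⟨k, by simpa [Nat.lt_succ_iff] using hk, rfl⟩
  have hcard : (Set.range fC ∩ Set.range fB).ncard ≤ m + 1 :=
    (Set.ncard_le_ncard hsub).trans <|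
      (Set.ncard_image_le (Finset.finite_toSet _)).trans (by simp)
  by_contra hgt
  have hm : 4 ≤ m := by omega
  have hb := hB.isPeriodicCycle (p + 2)
  have hbrange : Set.range (fun z : ℤ => fB (p + 2 + z)) = Set.range fB := by
    ext v
    constructor
    · rintro ⟨z, rfl⟩
      exact ⟨_, rfl⟩
    · rintro ⟨i, rfl⟩
      obtain ⟨z, hz⟩ := ZMod.intCast_surjective (i - (p + 2))
      exact ⟨z, by simp [hz]⟩
  have hmem : ∀ z : ℤ, -2 ≤ z → z ≤ 2 → fB (p + 2 + z) ∈ Set.range fC := by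
    intro z h1 h2
    have : p + 2 + (z : ZMod ℓ) ∈ {i : ZMod ℓ | fB i ∈ Set.range fC} := by
      rw [hpm]
      refine ⟨(z + 2).toNat, by omega, ?_⟩
      have : ((z + 2).toNat : ZMod ℓ) = ((z + 2 : ℤ) : ZMod ℓ) := by
        rw [← Int.cast_natCast, Int.toNat_of_nonneg (by omega)]
      rw [this]
      push_cast
      ring
    exact this
  set b : ℤ → V := fun z : ℤ => fB (p + 2 + z)
  have havoid : ∀ v ∈ Set.range fC, v ∉ Set.range b → ∀ z : ℤ, -1 ≤ z → z ≤ 1 →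
      ¬ R.Adj v (b z) := by
    intro v hv hvb z h1 h2 h
    have hne : b (z - 1) ≠ b (z + 1) := by
      rw [Ne, hb.eq_iff]
      intro hd
      have := Int.le_of_dvd (by omega) ((dvd_neg).2 hd)
      omega
    rcases hC.eq_or_eq_of_adj (hmem z (by omega) (by omega))
      (hmem (z - 1) (by omega) (by omega)) (hmem (z + 1) (by omega) (by omega)) hv hne
      (hb.adj_pred (by omega)) (hb.adj_succ rfl) h.symm with e | e
    · exact hvb ⟨_, e.symm⟩
    · exact hvb ⟨_, e.symm⟩
  obtain ⟨t, ht⟩ := hmem 0 (by omega) (by omega)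
  refine hb.not_odd_closed_walk (by omega) (by exact_mod_cast heven) h3 h5 hF1 hF2 hodd
    (g := fun j : ℕ => fC (t + j)) (fun j => ?_) ?_ ?_ fun j hj => ?_
  · rw [hC.2.2]
    right
    push_cast
    ring
  · simpa [b] using ht
  · simpa [b] using ht
  · have := havoid _ ⟨_, rfl⟩ hj
    exact ⟨this 0 (by omega) (by omega), this 1 (by omega) (by omega),
      this (-1) (by omega) (by omega)⟩
end

section
/- Let G be a connected graph. If G contains none of the following as induced subgraphs: the claw, C_4*, S_3, the net, W_4, W_5, and the complement of C_6, then G is a proper Helly circular-arc graph. -/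
/-- An orientation in which in- and out-neighbourhoods are transitive tournaments. -/
structure IsRoundLocalTournament {α : Type*} (R : α → α → Prop) : Prop where
  asymm : ∀ p q, R p q → ¬ R q p
  out_total : ∀ p q r, R p q → R p r → q ≠ r → R q r ∨ R r q
  in_total : ∀ p q r, R q p → R r p → q ≠ r → R q r ∨ R r q
  no_triangle : ∀ p q r, R p q → R q r → ¬ R r p

/-- `q` is the first out-neighbour of `p`. -/
def IsNext {α : Type*} (R : α → α → Prop) (p q : α) : Prop :=
  R p q ∧ ∀ r, R p r → r = q ∨ R q r

namespace IsRoundLocalTournament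

variable {α : Type*} {R : α → α → Prop} (h : IsRoundLocalTournament R)
include h

theorem irrefl (p : α) : ¬ R p p := fun hp => h.asymm p p hp hp

theorem trans_out {p q r t : α} (hq : R p q) (ht : R p t) (hqr : R q r) (hrt : R r t) :
    R q t := by
  have hne : q ≠ t := by
    rintro rfl
    exact h.asymm _ _ hqr hrt
  exact (h.out_total p q t hq ht hne).resolve_right (h.no_triangle _ _ _ hqr hrt)

theorem exists_isNext [Finite α] {p q : α} (hpq : R p q) : ∃ y, IsNext R p y := by
  classical
  have := Fintype.ofFinite α
  obtain ⟨y, hy, hmax⟩ := Finset.exists_max_image (Finset.univ.filter fun y => R p y)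
    (fun y => (Finset.univ.filter fun t => R p t ∧ R y t).card) ⟨q, by simpa using hpq⟩
  simp only [Finset.mem_filter, Finset.mem_univ, true_and] at hy hmax
  refine ⟨y, hy, fun r hr => ?_⟩
  by_contra! hcon
  have hry : R r y := (h.out_total p r y hr hy hcon.1).resolve_right hcon.2
  refine (hmax r hr).not_gt (Finset.card_lt_card ?_)
  refine (Finset.ssubset_iff_of_subset fun t ht => ?_).2 ⟨y, ?_, ?_⟩
  · simp only [Finset.mem_filter, Finset.mem_univ, true_and] at ht ⊢
    exact ⟨ht.1, h.trans_out hr ht.1 hry ht.2⟩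
  · simpa using ⟨hy, hry⟩
  · simpa using fun _ => h.irrefl y

theorem isNext_right_unique {p q r : α} (hq : IsNext R p q) (hr : IsNext R p r) : q = r := by
  rcases hq.2 r hr.1 with e | e
  · exact e.symm
  · rcases hr.2 q hq.1 with e' | e'
    · exact e'
    · exact absurd e (h.asymm _ _ e')

theorem last_of_isNext {p q r : α} (hq : IsNext R p q) (hr : R r q) : r = p ∨ R r p := by
  by_contra! hcon
  rcases h.in_total q r p hr hq.1 hcon.1 with e | e
  · exact hcon.2 e
  · rcases hq.2 r e with rfl | e'
    · exact h.irrefl _ hr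
    · exact h.asymm _ _ hr e'

theorem isNext_left_unique {p q r : α} (hp : IsNext R p r) (hq : IsNext R q r) : p = q := by
  rcases h.last_of_isNext hp hq.1 with e | e
  · exact e.symm
  · rcases h.last_of_isNext hq hp.1 with e' | e'
    · exact e'
    · exact absurd e (h.asymm _ _ e')

/-- If `R p q`, iterating `IsNext` from `p` reaches `q` through in-neighbours of `q`. -/
theorem chain_induction [Finite α] {q : α} {P : α → Prop} (hbase : P q)
    (hstep : ∀ p y, R p q → IsNext R p y → P y → P p) {p : α} (hpq : R p q) : P p := by
  classical
  have := Fintype.ofFinite α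
  induction hn : (Finset.univ.filter fun t => R p t ∧ R t q).card using
    Nat.strong_induction_on generalizing p with
  | _ n ih =>
    obtain ⟨y, hy⟩ := h.exists_isNext hpq
    refine hstep p y hpq hy ?_
    rcases hy.2 q hpq with rfl | hyq
    · exact hbase
    refine ih _ ?_ hyq rfl
    rw [← hn]
    refine Finset.card_lt_card ((Finset.ssubset_iff_of_subset fun t ht => ?_).2 ⟨y, ?_, ?_⟩)
    · simp only [Finset.mem_filter, Finset.mem_univ, true_and] at ht ⊢
      refine ⟨?_, ht.2⟩
      have hne : p ≠ t := by
        rintro rfl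
        exact h.asymm _ _ hy.1 ht.1
      exact (h.in_total q p t hpq ht.2 hne).resolve_right (h.no_triangle _ _ _ hy.1 ht.1)
    · simpa using ⟨hy.1, hyq⟩
    · simpa using fun hyy => absurd hyy (h.irrefl y)

theorem reflTransGen_isNext [Finite α] {p q : α} (hpq : R p q) :
    Relation.ReflTransGen (IsNext R) p q :=
  h.chain_induction (P := fun p => Relation.ReflTransGen (IsNext R) p q) .refl
    (fun _ _ _ hy hyq => .head hy hyq) hpq

theorem comparable_of_eqvGen [Finite α] {p q : α} (hpq : Relation.EqvGen R p q) :
    Relation.ReflTransGen (IsNext R) p q ∨ Relation.ReflTransGen (IsNext R) q p := by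
  have hleft : Relator.LeftUnique (IsNext R) := fun _ _ _ h₁ h₂ => h.isNext_left_unique h₁ h₂
  have hright : Relator.RightUnique (IsNext R) := fun _ _ _ h₁ h₂ => h.isNext_right_unique h₁ h₂
  have hright' : Relator.RightUnique (Function.swap (IsNext R)) := fun _ _ _ h₁ h₂ => hleft h₁ h₂
  induction hpq with
  | rel _ _ hr => exact .inl (h.reflTransGen_isNext hr)
  | refl _ => exact .inl .refl
  | symm _ _ _ ih => exact ih.symm
  | trans x y z _ _ ih₁ ih₂ =>
    rcases ih₁ with a | a <;> rcases ih₂ with b | b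
    · exact .inl (a.trans b)
    · have := Relation.ReflTransGen.total_of_right_unique hright'
        (Relation.reflTransGen_swap.2 a) (Relation.reflTransGen_swap.2 b)
      exact this.symm.imp Relation.reflTransGen_swap.1 Relation.reflTransGen_swap.1
    · exact Relation.ReflTransGen.total_of_right_unique hright a b
    · exact .inr (b.trans a)

/-- An involution reversing `R` never preserves a weak component
if it moves no element to itself or to a neighbour. -/
theorem not_eqvGen_of_reversing [Finite α] {σ : α → α} (hσσ : ∀ p, σ (σ p) = p)
    (hσ : ∀ p q, R p q → R (σ q) (σ p)) (hfix : ∀ p, σ p ≠ p) (hadj : ∀ p, ¬ R p (σ p)) (p : α) :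
    ¬ Relation.EqvGen R p (σ p) := by
  have hnext : ∀ p q, IsNext R p q → IsNext R (σ q) (σ p) := fun p q hpq => by
    refine ⟨hσ _ _ hpq.1, fun r hr => ?_⟩
    have hr' : R (σ r) q := by simpa [hσσ] using hσ _ _ hr
    rcases h.last_of_isNext hpq hr' with e | e
    · exact .inl (by rw [← e, hσσ])
    · exact .inr (by simpa [hσσ] using hσ _ _ e)
  have key : ∀ (k : ℕ) (s : ℕ → α), (∀ i < k, IsNext R (s i) (s (i + 1))) → s k ≠ σ (s 0) := by
    intro k
    induction k using Nat.twoStepInduction with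
    | zero => exact fun s _ e => hfix _ e.symm
    | one => exact fun s hs e => hadj (s 0) (e ▸ (hs 0 one_pos).1)
    | more k ih _ =>
      intro s hs e
      refine ih (fun i => s (i + 1)) (fun i hi => hs (i + 1) (by lia)) ?_
      have h₁ := hnext _ _ (hs 0 (by lia))
      have h₂ := hs (k + 1) (by lia)
      rw [show k + 1 + 1 = k + 2 from rfl, e] at h₂
      exact h.isNext_left_unique h₂ h₁
  have seq : ∀ p q, Relation.ReflTransGen (IsNext R) p q →
      ∃ (k : ℕ) (s : ℕ → α), (∀ i < k, IsNext R (s i) (s (i + 1))) ∧ s 0 = p ∧ s k = q := by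
    intro p q hpq
    induction hpq using Relation.ReflTransGen.head_induction_on with
    | refl => exact ⟨0, fun _ => q, by simp⟩
    | head hac _ ih =>
      obtain ⟨k, s, hs, h0, hk⟩ := ih
      rename_i a c _
      refine ⟨k + 1, fun i => Nat.casesOn i a s, fun i hi => ?_, rfl, hk⟩
      cases i with
      | zero => simpa [h0] using hac
      | succ i => exact hs i (by lia)
  intro hp
  rcases h.comparable_of_eqvGen hp with e | e
  · obtain ⟨k, s, hs, h0, hk⟩ := seq _ _ e
    exact key k s hs (by rw [h0, hk])
  · obtain ⟨k, s, hs, h0, hk⟩ := seq _ _ e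
    exact key k s hs (by rw [h0, hk, hσσ])

end IsRoundLocalTournament

namespace IsRoundLocalTournament

variable {α : Type*} {R : α → α → Prop} (h : IsRoundLocalTournament R)
include h

/-- The partial map `IsNext` of a weakly connected round local tournament extends to
a cyclic permutation. -/
theorem exists_cyclic_perm [Finite α] [Nonempty α] (hconn : ∀ p q, Relation.EqvGen R p q) :
    ∃ f : Equiv.Perm α, (∀ p q, R p q → IsNext R p (f p)) ∧ ∀ p q, f.SameCycle p q := by
  classical
  have := Fintype.ofFinite α
  have chain : ∀ {f : Equiv.Perm α}, (∀ p q, R p q → IsNext R p (f p)) →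
      ∀ {p q}, Relation.ReflTransGen (IsNext R) p q → f.SameCycle p q := by
    intro f hf p q hpq
    induction hpq with
    | refl => exact .refl _ _
    | tail _ hbc ih =>
      rw [h.isNext_right_unique hbc (hf _ _ hbc.1)]
      exact Equiv.Perm.sameCycle_apply_right.2 ih
  have same : ∀ {f : Equiv.Perm α}, (∀ p q, R p q → IsNext R p (f p)) →
      ∀ p q, f.SameCycle p q := fun hf p q =>
    (h.comparable_of_eqvGen (hconn p q)).elim (chain hf) fun e => (chain hf e).symm
  suffices ∃ f : α → α, Function.Injective f ∧ ∀ p q, R p q → IsNext R p (f p) by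
    obtain ⟨f, hinj, hf⟩ := this
    exact ⟨Equiv.ofBijective f (Finite.injective_iff_bijective.1 hinj), hf, same hf⟩
  have hex : ∀ p, ∃ y, ∀ q, R p q → IsNext R p y := fun p => by
    by_cases hp : ∃ q, R p q
    · obtain ⟨q, hq⟩ := hp
      obtain ⟨y, hy⟩ := h.exists_isNext hq
      exact ⟨y, fun _ _ => hy⟩
    · exact ⟨p, fun q hq => absurd ⟨q, hq⟩ hp⟩
  choose g hg using hex
  by_cases hsink : ∃ t, ∀ q, ¬ R t q
  · obtain ⟨t, ht⟩ := hsink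
    have hnt : ∀ p, p ≠ t → ∃ q, R p q := fun p hp => by
      rcases h.comparable_of_eqvGen (hconn p t) with e | e
      · rcases Relation.ReflTransGen.cases_head e with e | ⟨c, hc, -⟩
        · exact absurd e hp
        · exact ⟨c, hc.1⟩
      · rcases Relation.ReflTransGen.cases_head e with e | ⟨c, hc, -⟩
        · exact absurd e.symm hp
        · exact absurd hc.1 (ht c)
    have hginj : ∀ p q, p ≠ t → q ≠ t → g p = g q → p = q := fun p q hp hq e => by
      obtain ⟨p', hp'⟩ := hnt p hp
      obtain ⟨q', hq'⟩ := hnt q hq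
      exact h.isNext_left_unique (hg p p' hp') (e ▸ hg q q' hq')
    obtain ⟨s, hs⟩ : ∃ s, s ∉ (Finset.univ.erase t).image g := by
      by_contra! hall
      have h₁ : Fintype.card α ≤ ((Finset.univ.erase t).image g).card :=
        Finset.card_le_card fun x _ => hall x
      have h₂ := h₁.trans Finset.card_image_le
      rw [Finset.card_erase_of_mem (Finset.mem_univ t), Finset.card_univ] at h₂
      have : 0 < Fintype.card α := Fintype.card_pos
      lia
    have hs' : ∀ p, p ≠ t → g p ≠ s := fun p hp e =>
      hs (Finset.mem_image.2 ⟨p, by simpa using hp, e⟩)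
    refine ⟨Function.update g t s, fun p q e => ?_, fun p q hpq => ?_⟩
    · by_cases hp : p = t <;> by_cases hq : q = t
      · rw [hp, hq]
      · subst hp
        rw [Function.update_self, Function.update_of_ne hq] at e
        exact absurd e.symm (hs' q hq)
      · subst hq
        rw [Function.update_self, Function.update_of_ne hp] at e
        exact absurd e (hs' p hp)
      · rw [Function.update_of_ne hq, Function.update_of_ne hp] at e
        exact hginj p q hp hq e
    · rw [Function.update_of_ne (by rintro rfl; exact ht q hpq)]
      exact hg p q hpq
  · push Not at hsink
    refine ⟨g, fun p q e => ?_, hg⟩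
    obtain ⟨p', hp'⟩ := hsink p
    obtain ⟨q', hq'⟩ := hsink q
    exact h.isNext_left_unique (hg p p' hp') (e ▸ hg q q' hq')

/-- With respect to a cyclic permutation extending `IsNext`, the closed out-neighbourhoods are
intervals `p, f p, …, f^[d p] p`. -/
theorem exists_outdegree [Finite α] {f : Equiv.Perm α}
    (hf : ∀ p q, R p q → IsNext R p (f p)) {n : ℕ} (hn : 0 < n)
    (hper : ∀ p, f^[n] p = p) (hmin : ∀ p k, 0 < k → k < n → f^[k] p ≠ p) :
    ∃ d : α → ℕ, (∀ p, d p < n) ∧ (∀ p, d p ≤ d (f p) + 1) ∧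
      ∀ p q, R p q ↔ ∃ k, 0 < k ∧ k ≤ d p ∧ f^[k] p = q := by
  classical
  have path : ∀ p q, R p q → ∃ k, 0 < k ∧ f^[k] p = q ∧ ∀ j < k, R (f^[j] p) q := by
    intro p q hpq
    suffices p = q ∨ ∃ k, 0 < k ∧ f^[k] p = q ∧ ∀ j < k, R (f^[j] p) q by
      rcases this with rfl | e
      · exact absurd hpq (h.irrefl p)
      · exact e
    refine h.chain_induction (q := q)
      (P := fun p => p = q ∨ ∃ k, 0 < k ∧ f^[k] p = q ∧ ∀ j < k, R (f^[j] p) q)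
      (.inl rfl) ?_ hpq
    intro a y haq hay ih
    obtain rfl := h.isNext_right_unique hay (hf a q haq)
    rcases ih with e | ⟨k, hk, hkq, hj⟩
    · refine .inr ⟨1, one_pos, by simpa using e, fun j hj => ?_⟩
      obtain rfl : j = 0 := by lia
      exact haq
    · refine .inr ⟨k + 1, by lia, hkq, fun j hjk => ?_⟩
      cases j with
      | zero => exact haq
      | succ j => exact hj j (by lia)
  have path' : ∀ p q, R p q → ∃ k, 0 < k ∧ f^[k] p = q ∧ ∀ j, 0 < j → j ≤ k → R p (f^[j] p) := by
    intro p q hpq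
    obtain ⟨k, hk, hkq, hin⟩ := path p q hpq
    refine ⟨k, hk, hkq, fun j hj => ?_⟩
    induction j, hj using Nat.le_induction with
    | base => exact fun _ => (hf p q hpq).1
    | succ j hj ih =>
      intro hjk
      have hpj := ih (by lia)
      have hj' := hf _ _ (hin j (by lia))
      rw [← Function.iterate_succ_apply' f] at hj'
      rcases hjk.eq_or_lt with e | hlt
      · rwa [e, hkq]
      · have hne : p ≠ f^[j + 1] p := fun e => h.asymm _ _ hpj (by simpa [← e] using hj'.1)
        exact (h.in_total _ _ _ hpq (hin _ hlt) hne).resolve_right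
          (h.no_triangle _ _ _ hpj hj'.1)
  let Q : α → ℕ → Prop := fun p k => ∀ j, 0 < j → j ≤ k → R p (f^[j] p)
  have hQlt : ∀ p k, Q p k → k < n := fun p k hQ => by
    by_contra! hk
    exact h.irrefl p (by simpa [hper] using hQ n hn hk)
  let d : α → ℕ := fun p => Nat.findGreatest (Q p) n
  have hdQ : ∀ p, Q p (d p) := fun p =>
    Nat.findGreatest_spec (P := Q p) (m := 0) (Nat.zero_le n) fun j _ _ => by lia
  have hQd : ∀ p k, Q p k → k ≤ d p := fun p k hQ => Nat.le_findGreatest (hQlt p k hQ).le hQ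
  refine ⟨d, fun p => hQlt _ _ (hdQ p), fun p => ?_, fun p q => ⟨fun hpq => ?_, ?_⟩⟩
  · suffices Q (f p) (d p - 1) by
      have := hQd _ _ this
      lia
    intro j hj hjd
    have hR : R p (f^[j] (f p)) := hdQ p (j + 1) (by lia) (by lia)
    rcases (hf _ _ hR).2 _ hR with e | e
    · have := hQlt _ _ (hdQ p)
      exact absurd e (hmin _ _ hj (by lia))
    · exact e
  · obtain ⟨k, hk, hkq, hin⟩ := path' p q hpq
    exact ⟨k, hk, hQd p k hin, hkq⟩
  · rintro ⟨k, hk, hkd, rfl⟩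
    exact hdQ p k hk hkd

/-- A weakly connected round local tournament has a circular enumeration such that the
closed out-neighbourhoods are circular intervals. -/
theorem exists_enumeration [Finite α] [Nonempty α] (hconn : ∀ p q, Relation.EqvGen R p q) :
    ∃ (n : ℕ) (i d : α → ℕ), (∀ p, d p < n) ∧
      (∀ p, ∃ y, i y ≡ i p + 1 [MOD n] ∧ d p ≤ d y + 1) ∧
      (∀ p q, i p ≡ i q [MOD n] → p = q) ∧
      ∀ p q, R p q ↔ ∃ k, 0 < k ∧ k ≤ d p ∧ i q ≡ i p + k [MOD n] := by
  obtain ⟨f, hf, hcyc⟩ := h.exists_cyclic_perm hconn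
  let a : α := Classical.arbitrary α
  have hmem : ∀ p, p ∈ Function.periodicPts f := Function.Injective.mem_periodicPts f.injective
  set n := Function.minimalPeriod f a with hn
  have hn0 : 0 < n := Function.minimalPeriod_pos_of_mem_periodicPts (hmem a)
  have hiter : ∀ p, ∃ k, f^[k] a = p := fun p => by
    obtain ⟨k, -, hk⟩ := (hcyc a p).exists_pow_eq'
    exact ⟨k, by rw [← hk, Equiv.Perm.coe_pow]⟩
  choose i hi using hiter
  have hmod : ∀ k m, f^[k] a = f^[m] a ↔ k ≡ m [MOD n] := fun k m => by
    rw [← Function.iterate_mod_minimalPeriod_eq (n := k),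
      ← Function.iterate_mod_minimalPeriod_eq (n := m),
      Function.iterate_eq_iterate_iff_of_lt_minimalPeriod (Nat.mod_lt _ hn0) (Nat.mod_lt _ hn0)]
    rfl
  have hk : ∀ p q k, f^[k] p = q ↔ i q ≡ i p + k [MOD n] := fun p q k => by
    rw [← hmod, hi, add_comm, Function.iterate_add_apply, hi, eq_comm]
  have hperiod : ∀ p, Function.minimalPeriod f p = n := fun p => by
    rw [← hi p, Function.minimalPeriod_apply_iterate (hmem a)]
  obtain ⟨d, hdn, hd, hR⟩ := h.exists_outdegree hf hn0
    (fun p => hperiod p ▸ Function.iterate_minimalPeriod)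
    (fun p k hk0 hkn => Function.not_isPeriodicPt_of_pos_of_lt_minimalPeriod hk0.ne'
      ((hperiod p).symm ▸ hkn))
  refine ⟨n, i, d, hdn, fun p => ⟨f p, (hk p (f p) 1).1 rfl, hd p⟩, fun p q hpq => ?_,
    fun p q => ?_⟩
  · rw [← hi p, ← hi q, hmod]
    exact hpq
  · simp only [hR, hk]

end IsRoundLocalTournament

theorem circlePt_eq_iff {s t : ℝ} : circlePt s = circlePt t ↔ ∃ m : ℤ, s = t + m := by
  have hpi : (2 * Real.pi) ≠ 0 := by positivity
  constructor
  · intro hst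
    obtain ⟨hc, hs⟩ := Prod.ext_iff.1 hst
    obtain ⟨m, hm⟩ := Real.Angle.angle_eq_iff_two_pi_dvd_sub.1 (Real.Angle.cos_sin_inj hc hs)
    refine ⟨m, mul_left_cancel₀ hpi ?_⟩
    linarith
  · rintro ⟨m, rfl⟩
    have : 2 * Real.pi * (t + m) = 2 * Real.pi * t + m * (2 * Real.pi) := by ring
    simp only [circlePt, this, Real.cos_add_int_mul_two_pi, Real.sin_add_int_mul_two_pi]

theorem circlePt_mem_image_Icc {a b t : ℝ} :
    circlePt t ∈ circlePt '' Set.Icc a b ↔ ∃ m : ℤ, a ≤ t + m ∧ t + m ≤ b := by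
  constructor
  · rintro ⟨s, hs, hst⟩
    obtain ⟨m, rfl⟩ := circlePt_eq_iff.1 hst
    exact ⟨m, hs⟩
  · rintro ⟨m, hm⟩
    exact ⟨t + m, hm, circlePt_eq_iff.2 ⟨m, rfl⟩⟩

/-- Two arcs intersect iff one of them contains the starting point of the other. -/
theorem image_Icc_inter_nonempty_iff {a b c d : ℝ} (hab : a ≤ b) (hcd : c ≤ d) :
    (circlePt '' Set.Icc a b ∩ circlePt '' Set.Icc c d).Nonempty ↔
      circlePt c ∈ circlePt '' Set.Icc a b ∨ circlePt a ∈ circlePt '' Set.Icc c d := by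
  constructor
  · rintro ⟨_, ⟨t, ht, rfl⟩, hx⟩
    obtain ⟨m, hm⟩ := circlePt_mem_image_Icc.1 hx
    rcases le_total a (c - m) with hac | hac
    · refine .inl (circlePt_mem_image_Icc.2 ⟨-m, ?_⟩)
      push_cast
      constructor <;> linarith [ht.1, ht.2]
    · refine .inr (circlePt_mem_image_Icc.2 ⟨m, ?_⟩)
      constructor <;> linarith [ht.1, ht.2]
  · rintro (hc | ha)
    · exact ⟨_, hc, Set.mem_image_of_mem _ (Set.left_mem_Icc.2 hcd)⟩
    · exact ⟨_, Set.mem_image_of_mem _ (Set.left_mem_Icc.2 hab), ha⟩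

/-- The arc starting at `i / n` and reaching past `(i + d) / n` but not to `(i + d + 1) / n`. -/
noncomputable def gridArc (n i d : ℕ) : Set (ℝ × ℝ) :=
  circlePt '' Set.Icc ((i : ℝ) / n) ((i : ℝ) / n + (d + 1 : ℝ) / (n + 1))

theorem isUnitCircleArc_gridArc {n i d : ℕ} (hd : d < n) : IsUnitCircleArc (gridArc n i d) := by
  refine ⟨_, _, ?_, ?_, rfl⟩
  · rw [add_sub_cancel_left]
    positivity
  · rw [add_sub_cancel_left, div_lt_one (by positivity)]
    exact_mod_cast Nat.succ_lt_succ hd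

theorem start_mem_gridArc_iff {n i d j : ℕ} (hd : d < n) :
    circlePt ((j : ℝ) / n) ∈ gridArc n i d ↔ ∃ k, k ≤ d ∧ j ≡ i + k [MOD n] := by
  have hn : (0 : ℝ) < n := by exact_mod_cast Nat.zero_lt_of_lt hd
  have hdn : (d : ℝ) + 1 ≤ n := by exact_mod_cast hd
  rw [gridArc, circlePt_mem_image_Icc]
  constructor
  · rintro ⟨m, h₁, h₂⟩
    have e : (j : ℝ) / n + m = (i : ℝ) / n + ((j + m * n - i : ℤ) : ℝ) / n := by
      push_cast
      field_simp
      ring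
    rw [e] at h₁ h₂
    have h₁' : (0 : ℝ) ≤ ((j + m * n - i : ℤ) : ℝ) / n := by linarith
    rw [le_div_iff₀ hn, zero_mul] at h₁'
    have h₂' : ((j + m * n - i : ℤ) : ℝ) / n ≤ (d + 1 : ℝ) / (n + 1) := by linarith
    rw [div_le_div_iff₀ hn (by positivity)] at h₂'
    have h₃ : ((j + m * n - i : ℤ) : ℝ) < d + 1 := by nlinarith
    obtain ⟨k, hk⟩ := Int.eq_ofNat_of_zero_le (show (0 : ℤ) ≤ j + m * n - i by exact_mod_cast h₁')
    rw [hk] at h₃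
    refine ⟨k, Nat.lt_succ_iff.1 (by exact_mod_cast h₃), Nat.modEq_iff_dvd.2 ⟨m, ?_⟩⟩
    push_cast
    linarith
  · rintro ⟨k, hk, hmod⟩
    obtain ⟨m, hm⟩ := Nat.modEq_iff_dvd.1 hmod
    refine ⟨m, ?_⟩
    have hm' : (i : ℝ) + k - j = n * m := by exact_mod_cast hm
    have e : (j : ℝ) / n + m = (i : ℝ) / n + (k : ℝ) / n := by
      field_simp
      linarith
    have hkd : (k : ℝ) ≤ d := by exact_mod_cast hk
    rw [e]
    refine ⟨le_add_of_nonneg_right (by positivity), ?_⟩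
    rw [add_le_add_iff_left, div_le_div_iff₀ hn (by positivity)]
    nlinarith

theorem not_gridArc_subset {n i d j k e : ℕ} (hd : d < n) (hk : 0 < k) (hkd : k ≤ d)
    (hj : j ≡ i + k [MOD n]) (he : d ≤ e + k) : ¬ gridArc n j e ⊆ gridArc n i d := by
  have hn : (0 : ℝ) < n := by exact_mod_cast Nat.zero_lt_of_lt hd
  have hdn : (d : ℝ) + 1 ≤ n := by exact_mod_cast hd
  have hk' : (0 : ℝ) < k := by exact_mod_cast hk
  have hkd' : (k : ℝ) ≤ d := by exact_mod_cast hkd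
  have he' : (d : ℝ) ≤ e + k := by exact_mod_cast he
  obtain ⟨m, hm⟩ := Nat.modEq_iff_dvd.1 hj
  have hm' : (i : ℝ) + k - j = n * m := by exact_mod_cast hm
  have hstart : (j : ℝ) / n + m = (i : ℝ) / n + (k : ℝ) / n := by
    field_simp
    linarith
  have hl : (d + 1 : ℝ) / (n + 1) < 1 := by
    rw [div_lt_one (by positivity)]
    linarith
  have hkl : (k : ℝ) / n ≤ (d + 1 : ℝ) / (n + 1) := by
    rw [div_le_div_iff₀ hn (by positivity)]
    nlinarith
  have hend : (d + 1 : ℝ) / (n + 1) < (k : ℝ) / n + (e + 1 : ℝ) / (n + 1) := by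
    have h₁ : (k : ℝ) / (n + 1) < (k : ℝ) / n := div_lt_div_of_pos_left hk' hn (by linarith)
    have h₂ : (d + 1 : ℝ) / (n + 1) ≤ (k : ℝ) / (n + 1) + (e + 1 : ℝ) / (n + 1) := by
      rw [← add_div]
      exact div_le_div_of_nonneg_right (by linarith) (by positivity)
    linarith
  obtain ⟨τ, hτ₁, hτ₂⟩ := exists_between (lt_min hl hend)
  intro hsub
  have hmem : circlePt ((i : ℝ) / n + τ) ∈ gridArc n j e := by
    refine circlePt_mem_image_Icc.2 ⟨-m, ?_⟩
    push_cast
    constructor <;> linarith [hτ₂.le.trans (min_le_right _ _)]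
  obtain ⟨z, hz₁, hz₂⟩ := circlePt_mem_image_Icc.1 (hsub hmem)
  rcases le_or_gt 0 z with hz | hz
  · have : (0 : ℝ) ≤ z := by exact_mod_cast hz
    linarith
  · have : (z : ℝ) ≤ -1 := by exact_mod_cast Int.le_sub_one_of_lt hz
    linarith [hτ₂.trans_le (min_le_left _ _)]

theorem IsRoundLocalTournament.exists_sink_of_clique {α : Type*} [Finite α] {R : α → α → Prop}
    (h : IsRoundLocalTournament R) {S : Set α} (hS : S.Nonempty)
    (hclique : ∀ p ∈ S, ∀ q ∈ S, p ≠ q → R p q ∨ R q p) : ∃ t ∈ S, ∀ p ∈ S, p ≠ t → R p t := by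
  classical
  have := Fintype.ofFinite α
  obtain ⟨t, ht, hmax⟩ := Set.exists_max_image S
    (fun t => (Finset.univ.filter fun p => p ∈ S ∧ R p t).card) S.toFinite hS
  refine ⟨t, ht, fun p hp hne => ?_⟩
  by_contra hpt
  have htp : R t p := (hclique p hp t ht hne).resolve_left hpt
  refine (hmax p hp).not_gt (Finset.card_lt_card ?_)
  refine (Finset.ssubset_iff_of_subset fun r hr => ?_).2 ⟨t, ?_, ?_⟩
  · simp only [Finset.mem_filter, Finset.mem_univ, true_and] at hr ⊢
    refine ⟨hr.1, ?_⟩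
    have hrp : r ≠ p := by
      rintro rfl
      exact hpt hr.2
    exact (hclique r hr.1 p hp hrp).resolve_right fun hpr => h.no_triangle _ _ _ hr.2 htp hpr
  · simpa using ⟨ht, htp⟩
  · simpa using fun _ => h.irrefl t

/-- A graph with a weakly connected round orientation is a proper Helly circular-arc graph. -/
theorem IsRoundLocalTournament.isProperHellyCircularArcGraph {V : Type*} [Finite V] [Nonempty V]
    {G : SimpleGraph V} {R : V → V → Prop} (h : IsRoundLocalTournament R)
    (hconn : ∀ p q, Relation.EqvGen R p q) (hG : ∀ u v, G.Adj u v ↔ R u v ∨ R v u) :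
    IsProperHellyCircularArcGraph G := by
  obtain ⟨n, i, d, hdn, hmono, hinj, hR⟩ := h.exists_enumeration hconn
  have hstart : ∀ u v, circlePt ((i v : ℝ) / n) ∈ gridArc n (i u) (d u) ↔ v = u ∨ R u v := by
    intro u v
    rw [start_mem_gridArc_iff (hdn u), hR]
    constructor
    · rintro ⟨k, hk, hmod⟩
      rcases k.eq_zero_or_pos with rfl | hk0
      · exact .inl (hinj _ _ hmod)
      · exact .inr ⟨k, hk0, hk, hmod⟩
    · rintro (rfl | ⟨k, -, hk, hmod⟩)
      · exact ⟨0, Nat.zero_le _, .refl _⟩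
      · exact ⟨k, hk, hmod⟩
  have hinter : ∀ u v, (gridArc n (i u) (d u) ∩ gridArc n (i v) (d v)).Nonempty ↔
      u = v ∨ R u v ∨ R v u := by
    intro u v
    rw [gridArc, gridArc, image_Icc_inter_nonempty_iff
      (le_add_of_nonneg_right (by positivity)) (le_add_of_nonneg_right (by positivity)),
      ← gridArc, ← gridArc, hstart, hstart]
    tauto
  have hmono' : ∀ k u v, i u ≡ i v + k [MOD n] → d v ≤ d u + k := by
    intro k
    induction k with
    | zero => exact fun u v hmod => by rw [hinj _ _ hmod, add_zero]
    | succ k ih =>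
      intro u v hmod
      obtain ⟨y, hy, hd⟩ := hmono v
      have := ih u y (hmod.trans ((hy.add_right k).trans (by rw [add_assoc, add_comm 1])).symm)
      lia
  refine ⟨fun v => gridArc n (i v) (d v), ⟨fun v => isUnitCircleArc_gridArc (hdn v),
    fun u v huv => ?_⟩, fun u v huv => ?_, fun S hS => ?_⟩
  · rw [hG, hinter]
    tauto
  · have hne : u ≠ v := by
      rintro rfl
      exact ssubset_irrefl _ huv
    have hvu := ((hstart v u).1 (huv.1 ((hstart u u).2 (.inl rfl)))).resolve_left hne
    obtain ⟨k, hk, hkd, hmod⟩ := (hR v u).1 hvu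
    exact not_gridArc_subset (hdn v) hk hkd hmod (hmono' k u v hmod) huv.1
  · rcases S.eq_empty_or_nonempty with rfl | hne
    · simp
    obtain ⟨t, -, ht⟩ := h.exists_sink_of_clique hne fun p hp q hq hpq =>
      ((hinter p q).1 (hS p hp q hq)).resolve_left hpq
    refine ⟨circlePt ((i t : ℝ) / n), Set.mem_iInter₂.2 fun p hp => (hstart p t).2 ?_⟩
    by_cases hpt : p = t
    · exact .inl hpt.symm
    · exact .inr (ht p hp hpt)

theorem Relation.eqvGen_of_or {α : Type*} {R : α → α → Prop} {p q : α} (h : R p q ∨ R q p) :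
    Relation.EqvGen R p q :=
  h.elim (.rel _ _) fun e => .symm _ _ (.rel _ _ e)

/-- A labelling of the two sides of every vertex: `s v x` is the side of `v` on which its
neighbour `x` lies. Non-adjacent neighbours of `v` lie on opposite sides of `v`, and every
triangle has exactly one vertex separating the other two. -/
structure IsSideLabelling {V : Type*} (G : SimpleGraph V) (s : V → V → Bool) : Prop where
  ne_of_not_adj : ∀ v x y, G.Adj v x → G.Adj v y → x ≠ y → ¬ G.Adj x y → s v x ≠ s v y
  exists_separating : ∀ v x y, G.Adj v x → G.Adj v y → G.Adj x y →
    s v x ≠ s v y ∨ s x v ≠ s x y ∨ s y v ≠ s y x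
  separating_unique : ∀ v x y, G.Adj v x → G.Adj v y → G.Adj x y →
    s v x ≠ s v y → s x v = s x y

namespace IsSideLabelling

variable {V : Type*} {G : SimpleGraph V} {s : V → V → Bool}

/-- The arcs of the orientation double cover: a pair `(v, b)` is the vertex `v` facing its
side `b`. -/
def Cover (G : SimpleGraph V) (s : V → V → Bool) (p q : V × Bool) : Prop :=
  G.Adj p.1 q.1 ∧ s p.1 q.1 = p.2 ∧ s q.1 p.1 = !q.2

theorem cover_reverse {p q : V × Bool} (h : Cover G s p q) :
    Cover G s (q.1, !q.2) (p.1, !p.2) :=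
  ⟨h.1.symm, h.2.2, by simpa using h.2.1⟩

theorem cover_or_cover {v x : V} (h : G.Adj v x) (b : Bool) :
    ∃ c, Cover G s (v, b) (x, c) ∨ Cover G s (x, c) (v, b) := by
  by_cases hb : s v x = b
  · exact ⟨!s x v, .inl ⟨h, hb, by simp⟩⟩
  · exact ⟨s x v, .inr ⟨h.symm, rfl, Bool.eq_not.2 hb⟩⟩

variable (hs : IsSideLabelling G s)
include hs

theorem cover_out_total {p q r : V × Bool} (hq : Cover G s p q) (hr : Cover G s p r)
    (hne : q ≠ r) : Cover G s q r ∨ Cover G s r q := by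
  obtain ⟨p, a⟩ := p
  obtain ⟨q, b⟩ := q
  obtain ⟨r, c⟩ := r
  obtain ⟨hpq, h₁, h₂⟩ := hq
  obtain ⟨hpr, h₃, h₄⟩ := hr
  dsimp only at *
  have hqr : q ≠ r := by
    rintro rfl
    exact hne (by rw [h₂, Bool.not_inj_iff] at h₄; rw [h₄])
  have hadj : G.Adj q r := by
    by_contra hadj
    exact hs.ne_of_not_adj p q r hpq hpr hqr hadj (h₁.trans h₃.symm)
  have h₅ := hs.exists_separating p q r hpq hpr hadj
  have h₆ := hs.separating_unique q r p hadj hpq.symm hpr.symm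
  have h₇ := hs.separating_unique r q p hadj.symm hpr.symm hpq.symm
  simp only [Cover, hadj, hadj.symm, true_and]
  cases b <;> cases c <;> grind

theorem isRoundLocalTournament_cover : IsRoundLocalTournament (Cover G s) where
  asymm p q h h' := by
    have := h.2.1
    have := h'.2.2
    simp_all
  out_total _ _ _ := hs.cover_out_total
  in_total p q r hq hr hne := by
    have hrev : ∀ {p q : V × Bool}, Cover G s (q.1, !q.2) (p.1, !p.2) → Cover G s p q :=
      fun h => by simpa using cover_reverse h
    refine (hs.cover_out_total (cover_reverse hq) (cover_reverse hr) fun e => hne ?_).symm.imp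
      hrev hrev
    simpa [Prod.ext_iff] using e
  no_triangle p q r hpq hqr hrp := by
    obtain ⟨p, a⟩ := p
    obtain ⟨q, b⟩ := q
    obtain ⟨r, c⟩ := r
    obtain ⟨hpq, h₁, h₂⟩ := hpq
    obtain ⟨hqr, h₃, h₄⟩ := hqr
    obtain ⟨hrp, h₅, h₆⟩ := hrp
    dsimp only at *
    have := hs.separating_unique p q r hpq hrp.symm hqr
    simp_all

theorem isProperHellyCircularArcGraph [Finite V] (hconn : G.Connected) :
    IsProperHellyCircularArcGraph G := by
  have := hconn.nonempty
  have hround := hs.isRoundLocalTournament_cover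
  let v₀ : V := Classical.arbitrary V
  have hex : ∀ v, ∃ b, Relation.EqvGen (Cover G s) (v₀, true) (v, b) := by
    intro v
    suffices ∀ u, G.Walk u v → ∀ b, ∃ c, Relation.EqvGen (Cover G s) (u, b) (v, c) from
      this v₀ (hconn.preconnected v₀ v).some true
    intro u w
    induction w with
    | nil => exact fun b => ⟨b, .refl _⟩
    | cons hadj _ ih =>
      intro b
      obtain ⟨c, hc⟩ := cover_or_cover (s := s) hadj b
      obtain ⟨c', hc'⟩ := ih c
      exact ⟨c', (Relation.eqvGen_of_or hc).trans _ _ _ hc'⟩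
  choose b hb using hex
  have huniq : ∀ v c, Relation.EqvGen (Cover G s) (v₀, true) (v, c) → c = b v := by
    intro v c hc
    by_contra hne
    refine hround.not_eqvGen_of_reversing (σ := fun p => (p.1, !p.2)) (by simp)
      (fun _ _ => cover_reverse) (by simp [Prod.ext_iff]) (fun p hp => hp.1.ne rfl) (v, b v) ?_
    have : (!b v) = c := by
      cases c <;> simp_all
    exact this ▸ (hb v).symm.trans _ _ _ hc
  have hadj : ∀ u v, G.Adj u v ↔
      Cover G s (u, b u) (v, b v) ∨ Cover G s (v, b v) (u, b u) := by
    refine fun u v => ⟨fun huv => ?_, fun e => e.elim (·.1) (·.1.symm)⟩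
    obtain ⟨c, hc⟩ := cover_or_cover (s := s) huv (b u)
    have : c = b v := huniq v c <|
      (hb u).trans _ _ _ (Relation.eqvGen_of_or hc)
    rwa [this] at hc
  have hinj : ∀ {u v}, u ≠ v → ((u, b u) : V × Bool) ≠ (v, b v) := fun hne e =>
    hne (congrArg Prod.fst e)
  have hround' : IsRoundLocalTournament fun u v => Cover G s (u, b u) (v, b v) :=
    { asymm := fun _ _ => hround.asymm _ _
      out_total := fun _ _ _ h₁ h₂ hne => hround.out_total _ _ _ h₁ h₂ (hinj hne)
      in_total := fun _ _ _ h₁ h₂ hne => hround.in_total _ _ _ h₁ h₂ (hinj hne)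
      no_triangle := fun _ _ _ => hround.no_triangle _ _ _ }
  refine hround'.isProperHellyCircularArcGraph (fun u v => ?_) hadj
  obtain ⟨w⟩ := hconn.preconnected u v
  induction w with
  | nil => exact .refl _
  | cons huv _ ih =>
    exact .trans _ _ _ (Relation.eqvGen_of_or ((hadj _ _).1 huv)) ih

end IsSideLabelling

/-- The forbidden induced subgraphs, spelled out on vertices. -/
structure IsSmallFree {V : Type*} (G : SimpleGraph V) : Prop where
  claw : ∀ v a b c, G.Adj v a → G.Adj v b → G.Adj v c → a ≠ b → a ≠ c → b ≠ c →
    ¬ G.Adj a b → ¬ G.Adj a c → ¬ G.Adj b c → False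
  cycle4_star : ∀ a b c d w, G.Adj a b → G.Adj b c → G.Adj c d → G.Adj d a → a ≠ c → b ≠ d →
    ¬ G.Adj a c → ¬ G.Adj b d → ¬ G.Adj w a → ¬ G.Adj w b → ¬ G.Adj w c → ¬ G.Adj w d → False
  tent : ∀ a b c x y z, G.Adj a b → G.Adj b c → G.Adj c a → G.Adj x a → G.Adj x b → G.Adj y b →
    G.Adj y c → G.Adj z c → G.Adj z a → ¬ G.Adj x c → ¬ G.Adj y a → ¬ G.Adj z b →
    ¬ G.Adj x y → ¬ G.Adj y z → ¬ G.Adj x z → False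
  net : ∀ a b c x y z, G.Adj a b → G.Adj b c → G.Adj c a → G.Adj x a → G.Adj y b → G.Adj z c →
    ¬ G.Adj x b → ¬ G.Adj x c → ¬ G.Adj y a → ¬ G.Adj y c → ¬ G.Adj z a → ¬ G.Adj z b →
    ¬ G.Adj x y → ¬ G.Adj y z → ¬ G.Adj x z → False
  wheel4 : ∀ a b c d w, G.Adj a b → G.Adj b c → G.Adj c d → G.Adj d a → a ≠ c → b ≠ d →
    ¬ G.Adj a c → ¬ G.Adj b d → G.Adj w a → G.Adj w b → G.Adj w c → G.Adj w d → False
  wheel5 : ∀ a b c d e w, G.Adj a b → G.Adj b c → G.Adj c d → G.Adj d e → G.Adj e a →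
    ¬ G.Adj a c → ¬ G.Adj b d → ¬ G.Adj c e → ¬ G.Adj d a → ¬ G.Adj e b →
    G.Adj w a → G.Adj w b → G.Adj w c → G.Adj w d → G.Adj w e → False
  prism : ∀ a b c x y z, G.Adj a b → G.Adj b c → G.Adj c a → G.Adj x y → G.Adj y z → G.Adj z x →
    G.Adj a x → G.Adj b y → G.Adj c z → ¬ G.Adj a y → ¬ G.Adj a z → ¬ G.Adj b x →
    ¬ G.Adj b z → ¬ G.Adj c x → ¬ G.Adj c y → False

theorem containsInduced_of_fin {V : Type*} {G : SimpleGraph V} {n : ℕ} {H : SimpleGraph (Fin n)}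
    (f : Fin n → V) (hf : ∀ i j, i < j → f i ≠ f j ∧ (H.Adj i j ↔ G.Adj (f i) (f j))) :
    ContainsInduced G H := by
  refine ⟨f, fun i j e => ?_, fun i j => ?_⟩
  · rcases lt_trichotomy i j with hij | hij | hij
    · exact absurd e (hf i j hij).1
    · exact hij
    · exact absurd e.symm (hf j i hij).1
  · rcases lt_trichotomy i j with hij | rfl | hij
    · exact (hf i j hij).2
    · simp
    · rw [H.adj_comm, G.adj_comm]
      exact (hf j i hij).2

theorem isSmallFree_of_not_containsInduced {V : Type*} {G : SimpleGraph V}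
    (h1 : ¬ ContainsInduced G clawG) (h2 : ¬ HasCycleStar G 4)
    (h3 : ¬ ContainsInduced G tentS3) (h4 : ¬ ContainsInduced G netG)
    (h5 : ¬ ContainsInduced G W4G) (h6 : ¬ ContainsInduced G W5G)
    (h7 : ¬ ContainsInduced G compC6) : IsSmallFree G where
  claw v a b c _ _ _ _ _ _ _ _ _ := by
    refine h1 (containsInduced_of_fin ![v, a, b, c] fun i j hij => ?_)
    fin_cases i <;> fin_cases j <;> simp [clawG] at hij ⊢ <;> grind [G.adj_comm, G.ne_of_adj]
  cycle4_star a b c d w _ _ _ _ _ _ _ _ _ _ _ _ := by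
    refine h2 ⟨![a, b, c, d], w, ⟨by simp, ?_, ?_⟩, ?_⟩
    · intro i j e
      fin_cases i <;> fin_cases j <;> simp at e ⊢ <;> grind [G.ne_of_adj]
    · change ∀ i j : Fin 4, G.Adj (![a, b, c, d] i) (![a, b, c, d] j) ↔ (i = j + 1 ∨ j = i + 1)
      intro i j
      fin_cases i <;> fin_cases j <;> simp <;> grind [G.adj_comm]
    · intro i
      fin_cases i <;> simp <;> grind
  tent a b c x y z _ _ _ _ _ _ _ _ _ _ _ _ _ _ _ := by
    refine h3 (containsInduced_of_fin ![a, b, c, x, y, z] fun i j hij => ?_)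
    fin_cases i <;> fin_cases j <;> simp [tentS3] at hij ⊢ <;> grind [G.adj_comm, G.ne_of_adj]
  net a b c x y z _ _ _ _ _ _ _ _ _ _ _ _ _ _ _ := by
    refine h4 (containsInduced_of_fin ![a, b, c, x, y, z] fun i j hij => ?_)
    fin_cases i <;> fin_cases j <;> simp [netG] at hij ⊢ <;> grind [G.adj_comm, G.ne_of_adj]
  wheel4 a b c d w _ _ _ _ _ _ _ _ _ _ _ _ := by
    refine h5 (containsInduced_of_fin ![a, b, c, d, w] fun i j hij => ?_)
    fin_cases i <;> fin_cases j <;> simp [W4G] at hij ⊢ <;> grind [G.adj_comm, G.ne_of_adj]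
  wheel5 a b c d e w _ _ _ _ _ _ _ _ _ _ _ _ _ _ _ := by
    refine h6 (containsInduced_of_fin ![a, b, c, d, e, w] fun i j hij => ?_)
    fin_cases i <;> fin_cases j <;> simp [W5G] at hij ⊢ <;> grind [G.adj_comm, G.ne_of_adj]
  prism a b c x y z _ _ _ _ _ _ _ _ _ _ _ _ _ _ _ := by
    refine h7 (containsInduced_of_fin ![a, y, c, x, b, z] fun i j hij => ?_)
    fin_cases i <;> fin_cases j <;> simp [compC6, cycle6G] at hij ⊢ <;>
      grind [G.adj_comm, G.ne_of_adj]

namespace IsSmallFree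

variable {V : Type*} {G : SimpleGraph V}

theorem false_of_common_neighbors (h : IsSmallFree G) {x y z a b c : V} (hxy : G.Adj x y)
    (hyz : G.Adj y z) (hzx : G.Adj z x) (hax : ¬ G.Adj a x) (hay : G.Adj a y) (haz : G.Adj a z)
    (hbx : G.Adj b x) (hby : ¬ G.Adj b y) (hbz : G.Adj b z) (hcx : G.Adj c x) (hcy : G.Adj c y)
    (hcz : ¬ G.Adj c z) (ha : a ≠ x) (hb : b ≠ y) (hc : c ≠ z) : False := by
  by_cases hab : G.Adj a b
  · refine h.wheel4 a b x y z ?_ ?_ ?_ ?_ ?_ ?_ ?_ ?_ ?_ ?_ ?_ ?_ <;> grind [G.adj_comm]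
  by_cases hbc : G.Adj b c
  · refine h.wheel4 b c y z x ?_ ?_ ?_ ?_ ?_ ?_ ?_ ?_ ?_ ?_ ?_ ?_ <;> grind [G.adj_comm]
  by_cases hca : G.Adj c a
  · refine h.wheel4 c a z x y ?_ ?_ ?_ ?_ ?_ ?_ ?_ ?_ ?_ ?_ ?_ ?_ <;> grind [G.adj_comm]
  refine h.tent x y z c a b ?_ ?_ ?_ ?_ ?_ ?_ ?_ ?_ ?_ ?_ ?_ ?_ ?_ ?_ ?_ <;> grind [G.adj_comm]

theorem false_of_private_neighbors (h : IsSmallFree G) {x y z a b c : V} (hxy : G.Adj x y)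
    (hyz : G.Adj y z) (hzx : G.Adj z x) (hax : G.Adj a x) (hay : ¬ G.Adj a y) (haz : ¬ G.Adj a z)
    (hbx : ¬ G.Adj b x) (hby : G.Adj b y) (hbz : ¬ G.Adj b z) (hcx : ¬ G.Adj c x)
    (hcy : ¬ G.Adj c y) (hcz : G.Adj c z) : False := by
  by_cases hab : G.Adj a b
  · by_cases hbc : G.Adj b c
    · by_cases hca : G.Adj c a
      · refine h.prism x y z a b c ?_ ?_ ?_ ?_ ?_ ?_ ?_ ?_ ?_ ?_ ?_ ?_ ?_ ?_ ?_ <;>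
          grind [G.adj_comm]
      · refine h.claw b a c y ?_ ?_ ?_ ?_ ?_ ?_ ?_ ?_ ?_ <;> grind [G.adj_comm]
    · by_cases hca : G.Adj c a
      · refine h.claw a b c x ?_ ?_ ?_ ?_ ?_ ?_ ?_ ?_ ?_ <;> grind [G.adj_comm]
      · refine h.cycle4_star a b y x c ?_ ?_ ?_ ?_ ?_ ?_ ?_ ?_ ?_ ?_ ?_ ?_ <;> grind [G.adj_comm]
  · by_cases hbc : G.Adj b c
    · by_cases hca : G.Adj c a
      · refine h.claw c a b z ?_ ?_ ?_ ?_ ?_ ?_ ?_ ?_ ?_ <;> grind [G.adj_comm]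
      · refine h.cycle4_star b c z y a ?_ ?_ ?_ ?_ ?_ ?_ ?_ ?_ ?_ ?_ ?_ ?_ <;> grind [G.adj_comm]
    · by_cases hca : G.Adj c a
      · refine h.cycle4_star a c z x b ?_ ?_ ?_ ?_ ?_ ?_ ?_ ?_ ?_ ?_ ?_ ?_ <;> grind [G.adj_comm]
      · refine h.net x y z a b c ?_ ?_ ?_ ?_ ?_ ?_ ?_ ?_ ?_ ?_ ?_ ?_ ?_ ?_ ?_ <;>
          grind [G.adj_comm]

theorem false_of_private_common_common (h : IsSmallFree G) {x y z a b c : V} (hxy : G.Adj x y)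
    (hyz : G.Adj y z) (hzx : G.Adj z x) (hax : G.Adj a x) (hay : ¬ G.Adj a y) (haz : ¬ G.Adj a z)
    (hbx : G.Adj b x) (hby : ¬ G.Adj b y) (hbz : G.Adj b z) (hcx : G.Adj c x) (hcy : G.Adj c y)
    (hcz : ¬ G.Adj c z) (hb : b ≠ y) (hc : c ≠ z) : False := by
  by_cases hbc : G.Adj b c
  · refine h.wheel4 b c y z x ?_ ?_ ?_ ?_ ?_ ?_ ?_ ?_ ?_ ?_ ?_ ?_ <;> grind [G.adj_comm]
  by_cases hab : G.Adj a b
  · by_cases hac : G.Adj a c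
    · refine h.wheel5 y z b a c x ?_ ?_ ?_ ?_ ?_ ?_ ?_ ?_ ?_ ?_ ?_ ?_ ?_ ?_ ?_ <;>
        grind [G.adj_comm]
    · refine h.claw x a c z ?_ ?_ ?_ ?_ ?_ ?_ ?_ ?_ ?_ <;> grind [G.adj_comm]
  · refine h.claw x a b y ?_ ?_ ?_ ?_ ?_ ?_ ?_ ?_ ?_ <;> grind [G.adj_comm]

theorem false_of_private_private_common (h : IsSmallFree G) {x y z a b c : V} (hxy : G.Adj x y)
    (hyz : G.Adj y z) (hzx : G.Adj z x) (hax : G.Adj a x) (hay : ¬ G.Adj a y) (haz : ¬ G.Adj a z)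
    (hbx : ¬ G.Adj b x) (hby : G.Adj b y) (hbz : ¬ G.Adj b z) (hcx : G.Adj c x) (hcy : G.Adj c y)
    (hcz : ¬ G.Adj c z) (ha : a ≠ z) (hb : b ≠ z) (hc : c ≠ z) : False := by
  by_cases hac : G.Adj a c
  · by_cases hbc : G.Adj b c
    · by_cases hab : G.Adj a b
      · refine h.wheel4 a x y b c ?_ ?_ ?_ ?_ ?_ ?_ ?_ ?_ ?_ ?_ ?_ ?_ <;> grind [G.adj_comm]
      · refine h.tent x y c z b a ?_ ?_ ?_ ?_ ?_ ?_ ?_ ?_ ?_ ?_ ?_ ?_ ?_ ?_ ?_ <;>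
          grind [G.adj_comm]
    · refine h.claw y b c z ?_ ?_ ?_ ?_ ?_ ?_ ?_ ?_ ?_ <;> grind [G.adj_comm]
  · refine h.claw x a c z ?_ ?_ ?_ ?_ ?_ ?_ ?_ ?_ ?_ <;> grind [G.adj_comm]

end IsSmallFree

/-- The vertex `v` separates `x` from `y`: its closed neighbourhood lies between the
intersection and the union of the closed neighbourhoods of `x` and `y`. -/
def Separates {V : Type*} (G : SimpleGraph V) (v x y : V) : Prop :=
  ∀ w, ((x = w ∨ G.Adj x w) ∧ (y = w ∨ G.Adj y w) → v = w ∨ G.Adj v w) ∧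
    (v = w ∨ G.Adj v w → (x = w ∨ G.Adj x w) ∨ (y = w ∨ G.Adj y w))

theorem Separates.symm {V : Type*} {G : SimpleGraph V} {v x y : V} (h : Separates G v x y) :
    Separates G v y x :=
  fun w => ⟨fun e => (h w).1 e.symm, fun e => ((h w).2 e).symm⟩

theorem exists_of_not_separates {V : Type*} {G : SimpleGraph V} {v x y : V} (hvx : G.Adj v x)
    (hvy : G.Adj v y) (h : ¬ Separates G v x y) :
    ∃ w, w ≠ v ∧ w ≠ x ∧ w ≠ y ∧ (¬ G.Adj w v ∧ G.Adj w x ∧ G.Adj w y ∨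
      G.Adj w v ∧ ¬ G.Adj w x ∧ ¬ G.Adj w y) := by
  obtain ⟨w, hw⟩ := not_forall.1 h
  exact ⟨w, by grind [G.adj_comm]⟩

theorem IsSmallFree.exists_separates {V : Type*} {G : SimpleGraph V} (h : IsSmallFree G)
    {x y z : V} (hxy : G.Adj x y) (hyz : G.Adj y z) (hzx : G.Adj z x) :
    Separates G x y z ∨ Separates G y z x ∨ Separates G z x y := by
  by_contra! hn
  obtain ⟨a, _, _, _, ha⟩ := exists_of_not_separates hxy hzx.symm hn.1
  obtain ⟨b, _, _, _, hb⟩ := exists_of_not_separates hyz hxy.symm hn.2.1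
  obtain ⟨c, _, _, _, hc⟩ := exists_of_not_separates hzx hyz.symm hn.2.2
  obtain ⟨ha1, ha2, ha3⟩ | ⟨ha1, ha2, ha3⟩ := ha <;>
  obtain ⟨hb1, hb2, hb3⟩ | ⟨hb1, hb2, hb3⟩ := hb <;>
  obtain ⟨hc1, hc2, hc3⟩ | ⟨hc1, hc2, hc3⟩ := hc
  · exact h.false_of_common_neighbors hxy hyz hzx ha1 ha2 ha3 hb3 hb1 hb2 hc2 hc3 hc1
      ‹_› ‹_› ‹_›
  · exact h.false_of_private_common_common hzx hxy hyz hc1 hc2 hc3 ha3 ha1 ha2 hb2 hb3 hb1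
      ‹_› ‹_›
  · exact h.false_of_private_common_common hyz hzx hxy hb1 hb2 hb3 hc3 hc1 hc2 ha2 ha3 ha1
      ‹_› ‹_›
  · exact h.false_of_private_private_common hyz hzx hxy hb1 hb2 hb3 hc3 hc1 hc2 ha2 ha3 ha1
      ‹_› ‹_› ‹_›
  · exact h.false_of_private_common_common hxy hyz hzx ha1 ha2 ha3 hb3 hb1 hb2 hc2 hc3 hc1
      ‹_› ‹_›
  · exact h.false_of_private_private_common hzx hxy hyz hc1 hc2 hc3 ha3 ha1 ha2 hb2 hb3 hb1
      ‹_› ‹_› ‹_›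
  · exact h.false_of_private_private_common hxy hyz hzx ha1 ha2 ha3 hb3 hb1 hb2 hc2 hc3 hc1
      ‹_› ‹_› ‹_›
  · exact h.false_of_private_neighbors hxy hyz hzx ha1 ha2 ha3 hb3 hb1 hb2 hc2 hc3 hc1

/-- Distinct vertices have distinct closed neighbourhoods. -/
def TwinFree {V : Type*} (G : SimpleGraph V) : Prop :=
  ∀ u v, (∀ w, (u = w ∨ G.Adj u w) ↔ (v = w ∨ G.Adj v w)) → u = v

theorem TwinFree.not_separates {V : Type*} {G : SimpleGraph V} (ht : TwinFree G) {v x y : V}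
    (hvx : v ≠ x) (h : Separates G v x y) : ¬ Separates G x v y := by
  intro h'
  refine hvx (ht v x fun w => ?_)
  have := h w
  have := h' w
  grind

/-- The neighbours `x` and `y` of `v` lie on opposite sides of `v`. -/
def OppositeSides {V : Type*} (G : SimpleGraph V) (v x y : V) : Prop :=
  ¬ G.Adj x y ∨ Separates G v x y

theorem OppositeSides.symm {V : Type*} {G : SimpleGraph V} {v x y : V} (h : OppositeSides G v x y) :
    OppositeSides G v y x :=
  h.imp (fun e e' => e e'.symm) Separates.symm

namespace IsSmallFree

variable {V : Type*} {G : SimpleGraph V}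

theorem false_of_crossing (h : IsSmallFree G) {p q r s a b : V} (hpq : G.Adj p q) (hpr : G.Adj p r)
    (hps : G.Adj p s) (hqr : G.Adj q r) (hqs : G.Adj q s) (hrs : G.Adj r s) (hpa : G.Adj p a)
    (hqa : G.Adj q a) (hra : ¬ G.Adj r a) (hsa : ¬ G.Adj s a) (hpb : G.Adj p b)
    (hqb : ¬ G.Adj q b) (hrb : G.Adj r b) (hsb : ¬ G.Adj s b) (ha : s ≠ a) (hb : s ≠ b) :
    False := by
  by_cases hab : G.Adj a b
  · refine h.wheel4 a b r q p ?_ ?_ ?_ ?_ ?_ ?_ ?_ ?_ ?_ ?_ ?_ ?_ <;> grind [G.adj_comm]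
  · refine h.claw p a b s ?_ ?_ ?_ ?_ ?_ ?_ ?_ ?_ ?_ <;> grind [G.adj_comm]

variable (h : IsSmallFree G) (ht : TwinFree G)
include h ht

theorem false_of_separates_of_separates {v x y z : V} (hvx : G.Adj v x) (hvy : G.Adj v y)
    (hvz : G.Adj v z) (hxz : G.Adj x z) (hyz : G.Adj y z) (hne : x ≠ y) (hxy : ¬ G.Adj x y)
    (h₁ : Separates G v x z) (h₂ : Separates G v y z) : False := by
  have hsub : ∀ w, v = w ∨ G.Adj v w → z = w ∨ G.Adj z w := by
    intro w hw
    by_contra hn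
    have hx := (h₁ w).2 hw
    have hy := (h₂ w).2 hw
    refine h.wheel4 w x z y v ?_ ?_ ?_ ?_ ?_ ?_ ?_ ?_ ?_ ?_ ?_ ?_ <;> grind [G.adj_comm]
  have hnsub : ∃ w, (z = w ∨ G.Adj z w) ∧ ¬ (v = w ∨ G.Adj v w) := by
    by_contra! hn
    exact hvz.ne (ht v z fun w => ⟨hsub w, fun e => by grind⟩)
  obtain ⟨w, hz, hw⟩ := hnsub
  have hx := (h₁ w).1
  have hy := (h₂ w).1
  refine h.claw z w x y ?_ ?_ ?_ ?_ ?_ ?_ ?_ ?_ ?_ <;> grind [G.adj_comm]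

theorem not_opposite_of_opposite_of_opposite {v x y z : V} (hvx : G.Adj v x) (hvy : G.Adj v y)
    (hvz : G.Adj v z) (hxy : x ≠ y) (hxz : x ≠ z) (hyz : y ≠ z) (h₁ : OppositeSides G v x y)
    (h₂ : OppositeSides G v y z) : ¬ OppositeSides G v x z := by
  have two : ∀ {x y z : V}, G.Adj v x → x ≠ y → x ≠ z → ¬ G.Adj x y → ¬ G.Adj x z →
      ¬ Separates G v y z := fun {x y z} hx hy hz hxy hxz hs => by
    have := (hs x).2 (.inr hx)
    grind [G.adj_comm]
  intro h₃
  by_cases a₁ : G.Adj x y <;> by_cases a₂ : G.Adj y z <;> by_cases a₃ : G.Adj x z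
  · have s₁ := h₁.resolve_left (not_not.2 a₁)
    have s₂ := h₂.resolve_left (not_not.2 a₂)
    have s₃ := h₃.resolve_left (not_not.2 a₃)
    have hm : v = x ∨ v = y ∨ v = z := by
      obtain s | s | s := h.exists_separates a₁ a₂ a₃.symm
      · exact .inl (ht _ _ fun w => by grind [s w, s₁ w, s₂ w, s₃ w])
      · exact .inr (.inl (ht _ _ fun w => by grind [s w, s₁ w, s₂ w, s₃ w]))
      · exact .inr (.inr (ht _ _ fun w => by grind [s w, s₁ w, s₂ w, s₃ w]))
    exact hm.elim hvx.ne fun hm => hm.elim hvy.ne hvz.ne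
  · exact h.false_of_separates_of_separates ht hvx hvz hvy a₁ a₂.symm hxz a₃
      (h₁.resolve_left (not_not.2 a₁)) (h₂.resolve_left (not_not.2 a₂)).symm
  · exact h.false_of_separates_of_separates ht hvy hvz hvx a₁.symm a₃.symm hyz a₂
      (h₁.resolve_left (not_not.2 a₁)).symm (h₃.resolve_left (not_not.2 a₃)).symm
  · exact two hvz hxz.symm hyz.symm (fun e => a₃ e.symm) (fun e => a₂ e.symm)
      (h₁.resolve_left (not_not.2 a₁))
  · exact h.false_of_separates_of_separates ht hvx hvy hvz a₃ a₂ hxy a₁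
      (h₃.resolve_left (not_not.2 a₃)) (h₂.resolve_left (not_not.2 a₂))
  · exact two hvx hxy hxz a₁ a₃ (h₂.resolve_left (not_not.2 a₂))
  · exact two hvy hxy.symm hyz (fun e => a₁ e.symm) a₂ (h₃.resolve_left (not_not.2 a₃))
  · exact h.claw v x y z hvx hvy hvz hxy hxz hyz a₁ a₃ a₂

theorem false_of_separates_cyclic {v x y z : V} (hvx : G.Adj v x) (hvy : G.Adj v y)
    (hvz : G.Adj v z) (hxy : G.Adj x y) (hxz : G.Adj x z) (hyz : G.Adj y z)
    (sv : Separates G v x y) (sx : Separates G x v z) (sy : Separates G y v z)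
    (sz : Separates G z x y) : False := by
  obtain ⟨a, ha⟩ : ∃ a, ¬ ((v = a ∨ G.Adj v a) ↔ (x = a ∨ G.Adj x a)) := by
    by_contra! hn
    exact hvx.ne (ht _ _ hn)
  obtain ⟨b, hb⟩ : ∃ b, ¬ ((v = b ∨ G.Adj v b) ↔ (y = b ∨ G.Adj y b)) := by
    by_contra! hn
    exact hvy.ne (ht _ _ hn)
  have ne : ∀ {c q}, ¬ ((v = c ∨ G.Adj v c) ↔ (q = c ∨ G.Adj q c)) → q = x ∨ q = y →
      v ≠ c ∧ x ≠ c ∧ y ≠ c ∧ z ≠ c := by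
    intro c q hc hq
    refine ⟨?_, ?_, ?_, ?_⟩ <;> rintro rfl <;> grind [G.adj_comm]
  obtain ⟨na₁, na₂, na₃, na₄⟩ := ne ha (.inl rfl)
  obtain ⟨nb₁, nb₂, nb₃, nb₄⟩ := ne hb (.inr rfl)
  have hA := And.intro (And.intro (sv a) (sx a)) (And.intro (sy a) (sz a))
  have hB := And.intro (And.intro (sv b) (sx b)) (And.intro (sy b) (sz b))
  simp only [na₁, na₂, na₃, na₄, nb₁, nb₂, nb₃, nb₄, false_or] at hA hB ha hb
  replace hA : (G.Adj v a ∧ ¬ G.Adj x a ∧ G.Adj y a ∧ ¬ G.Adj z a) ∨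
    (¬ G.Adj v a ∧ G.Adj x a ∧ ¬ G.Adj y a ∧ G.Adj z a) := by
    clear ne hB hb
    by_cases p₁ : G.Adj v a <;> by_cases p₂ : G.Adj x a <;> by_cases p₃ : G.Adj y a <;>
      by_cases p₄ : G.Adj z a <;> simp [p₁, p₂, p₃, p₄] at hA ha ⊢
  replace hB : (G.Adj v b ∧ G.Adj x b ∧ ¬ G.Adj y b ∧ ¬ G.Adj z b) ∨
    (¬ G.Adj v b ∧ ¬ G.Adj x b ∧ G.Adj y b ∧ G.Adj z b) := by
    clear ne hA ha
    by_cases p₁ : G.Adj v b <;> by_cases p₂ : G.Adj x b <;> by_cases p₃ : G.Adj y b <;>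
      by_cases p₄ : G.Adj z b <;> simp [p₁, p₂, p₃, p₄] at hB hb ⊢
  obtain ⟨a₁, a₂, a₃, a₄⟩ | ⟨a₁, a₂, a₃, a₄⟩ := hA <;>
    obtain ⟨b₁, b₂, b₃, b₄⟩ | ⟨b₁, b₂, b₃, b₄⟩ := hB
  · exact h.false_of_crossing hvy hvx hvz hxy.symm hyz hxz a₁ a₃ a₂ a₄ b₁ b₃ b₂ b₄ na₄ nb₄
  · exact h.false_of_crossing hvy.symm hyz hxy.symm hvz hvx hxz.symm a₃ a₁ a₄ a₂ b₃ b₁ b₄ b₂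
      na₂ nb₂
  · exact h.false_of_crossing hxz hvx.symm hxy hvz.symm hyz.symm hvy a₂ a₄ a₁ a₃ b₂ b₄ b₁ b₃
      na₃ nb₃
  · exact h.false_of_crossing hxz.symm hyz.symm hvz.symm hxy hvx.symm hvy.symm a₄ a₂ a₃ a₁
      b₄ b₂ b₃ b₁ na₁ nb₁

theorem opposite_or_opposite {v x y z : V} (hvx : G.Adj v x) (hvy : G.Adj v y)
    (hvz : G.Adj v z) (hxy : x ≠ y) (h₁ : OppositeSides G v x y) :
    OppositeSides G v x z ∨ OppositeSides G v y z := by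
  by_contra! hn
  simp only [OppositeSides, not_or, not_not] at hn
  obtain ⟨⟨axz, nxz⟩, ayz, nyz⟩ := hn
  have txz := h.exists_separates hvx axz hvz.symm
  have tyz := h.exists_separates hvy ayz hvz.symm
  by_cases axy : G.Adj x y
  · have sv := h₁.resolve_left (not_not.2 axy)
    have txy := h.exists_separates axy ayz axz.symm
    obtain s₁ | s₁ := txz.resolve_left nxz <;> obtain s₂ | s₂ := tyz.resolve_left nyz <;>
      obtain s₃ | s₃ | s₃ := txy
    all_goals first
      | exact hvx.ne (ht _ _ fun w => by grind [s₁ w, s₂ w, s₃ w, sv w])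
      | exact hvy.ne (ht _ _ fun w => by grind [s₁ w, s₂ w, s₃ w, sv w])
      | exact hvz.ne (ht _ _ fun w => by grind [s₁ w, s₂ w, s₃ w, sv w])
      | exact h.false_of_separates_cyclic ht hvx hvy hvz axy axz ayz sv s₁.symm s₂.symm s₃
  · have s₁ := (txz.resolve_left nxz).resolve_left fun s => by
      grind [(s y).1, G.adj_comm]
    have s₂ := (tyz.resolve_left nyz).resolve_left fun s => by
      grind [(s x).1, G.adj_comm]
    exact h.false_of_separates_of_separates ht axz.symm ayz.symm hvz.symm hvx.symm hvy.symm
      hxy axy s₁.symm s₂.symm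

open Classical in
theorem exists_isSideLabelling : ∃ s : V → V → Bool, IsSideLabelling G s := by
  suffices key : ∃ s : V → V → Bool, ∀ v x y, G.Adj v x → G.Adj v y → x ≠ y →
      (s v x ≠ s v y ↔ OppositeSides G v x y) by
    obtain ⟨s, key⟩ := key
    refine ⟨s, fun v x y hx hy hxy a => (key v x y hx hy hxy).2 (.inl a), fun v x y hx hy a => ?_,
      fun v x y hx hy a e => ?_⟩
    · rw [key v x y hx hy a.ne, key x v y hx.symm a hy.ne, key y v x hy.symm a.symm hx.ne]
      obtain t | t | t := h.exists_separates hx a hy.symm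
      · exact .inl (.inr t)
      · exact .inr (.inl (.inr t.symm))
      · exact .inr (.inr (.inr t))
    · by_contra e'
      rw [← ne_eq, key x v y hx.symm a hy.ne] at e'
      rw [key v x y hx hy a.ne] at e
      exact ht.not_separates hx.ne (e.resolve_left (not_not.2 a))
        (e'.resolve_left (not_not.2 hy))
  have local_side : ∀ v, ∃ s : V → Bool, ∀ x y, G.Adj v x → G.Adj v y → x ≠ y →
      (s x ≠ s y ↔ OppositeSides G v x y) := by
    intro v
    by_cases hv : ∃ x₀, G.Adj v x₀
    · obtain ⟨o, ho⟩ := hv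
      refine ⟨fun x => decide (x ≠ o ∧ OppositeSides G v o x), fun x y hx hy hxy => ?_⟩
      by_cases hxo : x = o
      · subst hxo
        simp [hxy.symm]
      by_cases hyo : y = o
      · subst hyo
        simp [hxy]
        exact ⟨.symm, .symm⟩
      have h₁ := h.not_opposite_of_opposite_of_opposite ht hx ho hy hxo hxy (Ne.symm hyo)
      have h₂ := h.opposite_or_opposite ht ho hx hy (Ne.symm hxo)
      have h₃ := h.opposite_or_opposite ht ho hy hx (Ne.symm hyo)
      have h₄ : OppositeSides G v x o ↔ OppositeSides G v o x := ⟨.symm, .symm⟩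
      have h₅ : OppositeSides G v y x ↔ OppositeSides G v x y := ⟨.symm, .symm⟩
      simp only [hxo, hyo, ne_eq, not_false_eq_true, true_and, decide_eq_decide]
      have h₆ : OppositeSides G v y o ↔ OppositeSides G v o y := ⟨.symm, .symm⟩
      have h₇ := h.opposite_or_opposite ht hx hy ho hxy
      rw [h₄] at h₁
      rw [h₅] at h₃
      rw [h₄, h₆] at h₇
      by_cases p₁ : OppositeSides G v o x <;> by_cases p₂ : OppositeSides G v o y <;>
        by_cases p₃ : OppositeSides G v x y <;> simp [p₁, p₂, p₃] at h₁ h₂ h₃ h₇ ⊢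
    · exact ⟨fun _ => true, fun x _ hx => absurd ⟨x, hx⟩ hv⟩
  choose s hs using local_side
  exact ⟨s, hs⟩

end IsSmallFree

/-- Two vertices with the same closed neighbourhood. -/
def twinSetoid {V : Type*} (G : SimpleGraph V) : Setoid V where
  r u v := ∀ w, (u = w ∨ G.Adj u w) ↔ (v = w ∨ G.Adj v w)
  iseqv := ⟨fun _ _ => .rfl, fun h w => (h w).symm, fun h h' w => (h w).trans (h' w)⟩

/-- The graph obtained by keeping one vertex of every class of twins. -/
noncomputable def twinQuotient {V : Type*} (G : SimpleGraph V) :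
    SimpleGraph (Quotient (twinSetoid G)) :=
  G.comap Quotient.out

theorem twinQuotient_adj_mk {V : Type*} {G : SimpleGraph V} {u v : V}
    (h : (Quotient.mk (twinSetoid G) u) ≠ Quotient.mk (twinSetoid G) v) :
    (twinQuotient G).Adj (Quotient.mk _ u) (Quotient.mk _ v) ↔ G.Adj u v := by
  have hu : ∀ w, _ ↔ _ := Quotient.mk_out (s := twinSetoid G) u
  have hv : ∀ w, _ ↔ _ := Quotient.mk_out (s := twinSetoid G) v
  have hne : u ≠ v := fun e => h (congrArg _ e)
  have hne' : (Quotient.mk (twinSetoid G) u).out ≠ v := fun e => h (by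
    rw [← e, Quotient.out_eq])
  have hne'' : (Quotient.mk (twinSetoid G) u).out ≠ (Quotient.mk (twinSetoid G) v).out :=
    fun e => h (Quotient.out_injective e)
  change G.Adj (Quotient.mk (twinSetoid G) u).out (Quotient.mk (twinSetoid G) v).out ↔ _
  have h₁ := hu v
  have h₂ := hv (Quotient.mk (twinSetoid G) u).out
  grind [G.adj_comm]

theorem twinQuotient_twinFree {V : Type*} (G : SimpleGraph V) : TwinFree (twinQuotient G) := by
  intro p q
  induction p using Quotient.inductionOn with | h u
  induction q using Quotient.inductionOn with | h v
  intro h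
  by_contra hne
  refine hne (Quotient.sound fun w => ?_)
  have huv : G.Adj u v := by
    rw [← twinQuotient_adj_mk hne]
    exact ((h (Quotient.mk _ v)).2 (.inl rfl)).resolve_left hne
  have key : ∀ {a b w : V}, G.Adj a b → Quotient.mk (twinSetoid G) a = Quotient.mk _ w →
      b = w ∨ G.Adj b w := fun {a b w} hab e => by
    have := (Quotient.exact e : ∀ x, _ ↔ _) b
    grind [G.adj_comm]
  have hw := h (Quotient.mk _ w)
  by_cases hu : Quotient.mk (twinSetoid G) u = Quotient.mk _ w
  · have h₁ := key huv hu
    have := (Quotient.exact hu : ∀ x, _ ↔ _) w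
    grind
  by_cases hv : Quotient.mk (twinSetoid G) v = Quotient.mk _ w
  · have h₁ := key huv.symm hv
    have := (Quotient.exact hv : ∀ x, _ ↔ _) w
    grind
  rw [twinQuotient_adj_mk hu, twinQuotient_adj_mk hv] at hw
  have : u ≠ w := fun e => hu (congrArg _ e)
  have : v ≠ w := fun e => hv (congrArg _ e)
  grind

theorem SimpleGraph.Connected.twinQuotient {V : Type*} {G : SimpleGraph V} (h : G.Connected) :
    (twinQuotient G).Connected := by
  have := h.nonempty
  have : Nonempty (Quotient (twinSetoid G)) := ⟨Quotient.mk _ (Classical.arbitrary V)⟩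
  refine ⟨fun p q => ?_⟩
  induction p using Quotient.inductionOn with | h u
  induction q using Quotient.inductionOn with | h v
  obtain ⟨p⟩ := h.preconnected u v
  induction p with
  | nil => exact .rfl
  | @cons a b c hab _ ih =>
    by_cases e : Quotient.mk (twinSetoid G) a = Quotient.mk _ b
    · rw [e]
      exact ih
    · exact ((twinQuotient_adj_mk e).2 hab).reachable.trans ih

theorem IsSmallFree.comap {V W : Type*} {G : SimpleGraph V} (h : IsSmallFree G) {f : W → V}
    (hf : Function.Injective f) : IsSmallFree (G.comap f) where
  claw v a b c h₁ h₂ h₃ h₄ h₅ h₆ :=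
    h.claw (f v) (f a) (f b) (f c) h₁ h₂ h₃ (hf.ne h₄) (hf.ne h₅) (hf.ne h₆)
  cycle4_star a b c d w h₁ h₂ h₃ h₄ h₅ h₆ :=
    h.cycle4_star (f a) (f b) (f c) (f d) (f w) h₁ h₂ h₃ h₄ (hf.ne h₅) (hf.ne h₆)
  tent a b c x y z := h.tent (f a) (f b) (f c) (f x) (f y) (f z)
  net a b c x y z := h.net (f a) (f b) (f c) (f x) (f y) (f z)
  wheel4 a b c d w h₁ h₂ h₃ h₄ h₅ h₆ :=
    h.wheel4 (f a) (f b) (f c) (f d) (f w) h₁ h₂ h₃ h₄ (hf.ne h₅) (hf.ne h₆)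
  wheel5 a b c d e w := h.wheel5 (f a) (f b) (f c) (f d) (f e) (f w)
  prism a b c x y z := h.prism (f a) (f b) (f c) (f x) (f y) (f z)

theorem IsUnitCircleArc.nonempty {A : Set (ℝ × ℝ)} (h : IsUnitCircleArc A) : A.Nonempty := by
  obtain ⟨a, b, hab, -, rfl⟩ := h
  exact (Set.nonempty_Icc.2 (sub_nonneg.1 hab)).image _

theorem IsProperHellyCircularArcGraph.of_twinQuotient {V : Type*} {G : SimpleGraph V}
    (h : IsProperHellyCircularArcGraph (twinQuotient G)) : IsProperHellyCircularArcGraph G := by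
  obtain ⟨f, ⟨harc, hadj⟩, hproper, hhelly⟩ := h
  refine ⟨fun v => f (Quotient.mk _ v), ⟨fun v => harc _, fun u v huv => ?_⟩,
    fun u v => hproper _ _, fun S hS => ?_⟩
  · by_cases e : Quotient.mk (twinSetoid G) u = Quotient.mk _ v
    · simp only [e, Set.inter_self, (harc _).nonempty, iff_true]
      exact (((Quotient.exact e : ∀ w, _ ↔ _) v).2 (.inl rfl)).resolve_left huv
    · rw [← twinQuotient_adj_mk e]
      exact hadj _ _ e
  · obtain ⟨x, hx⟩ := hhelly (Quotient.mk _ '' S) (by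
      rintro _ ⟨u, hu, rfl⟩ _ ⟨v, hv, rfl⟩
      exact hS u hu v hv)
    refine ⟨x, ?_⟩
    simpa using hx

/-- A connected graph containing none of the claw, `C_4*`, `S_3`,
the net, `W_4`, `W_5`, or the complement of `C_6` as an induced subgraph is a
proper Helly circular-arc graph. -/
theorem small_free_connected_is_phcag {V : Type*} [Fintype V] (G : SimpleGraph V)
    (hconn : G.Connected)
    (h1 : ¬ ContainsInduced G clawG) (h2 : ¬ HasCycleStar G 4)
    (h3 : ¬ ContainsInduced G tentS3) (h4 : ¬ ContainsInduced G netG)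
    (h5 : ¬ ContainsInduced G W4G) (h6 : ¬ ContainsInduced G W5G)
    (h7 : ¬ ContainsInduced G compC6) :
    IsProperHellyCircularArcGraph G := by
  have h := isSmallFree_of_not_containsInduced h1 h2 h3 h4 h5 h6 h7
  have h' : IsSmallFree (twinQuotient G) := h.comap Quotient.out_injective
  obtain ⟨s, hs⟩ := h'.exists_isSideLabelling (twinQuotient_twinFree G)
  exact .of_twinQuotient (hs.isProperHellyCircularArcGraph hconn.twinQuotient)
end
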